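/- Under the time-dependent stability setup with hypotheses (H1), (H2), (H3'), suppose for each n ∈ ℕ the function u^n : (0,∞) × X_n → ℝ is a metric viscosity subsolution of ∂_t u^n + H_n(t, x, u^n, |∇_{d_n} u^n|) = 0 on (0,∞) × X_n, and the family (u^n) is uniformly bounded. Then the upper semilimit ū(t,x) := sup{ limsup_{n→∞} u^n(t_n, x_n) : t_n → t, x_n ∈ X_n, 𝖽(x_n, x) → 0 }, defined for t > 0 and x ∈ X_∞, is a metric viscosity subsolution of ∂_t ū + H_∞(t, x, ū, |∇_{d_∞} ū|) = 0 on (0,∞) × X_∞. -/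

import Mathlib

open Filter Metric Set Topology

/-- Local slope of `u` at `x`, relative to a set `s` and a distance-like function `ρ`. -/
noncomputable def slopeWrt {α : Type*} [TopologicalSpace α] (s : Set α) (ρ : α → α → ℝ)
    (u : α → ℝ) (x : α) : ℝ :=
  Filter.limsup (fun y => |u y - u x| / ρ x y) (nhdsWithin x (s \ {x}))

/-- Upper local slope. -/
noncomputable def upperSlopeWrt {α : Type*} [TopologicalSpace α] (s : Set α) (ρ : α → α → ℝ)
    (u : α → ℝ) (x : α) : ℝ :=
  Filter.limsup (fun y => max (u y - u x) 0 / ρ x y) (nhdsWithin x (s \ {x}))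

/-- Lower local slope. -/
noncomputable def lowerSlopeWrt {α : Type*} [TopologicalSpace α] (s : Set α) (ρ : α → α → ℝ)
    (u : α → ℝ) (x : α) : ℝ :=
  Filter.limsup (fun y => max (u x - u y) 0 / ρ x y) (nhdsWithin x (s \ {x}))

/-- `u` is locally Lipschitz on `s` with respect to `ρ`. -/
def LocLipWrt {α : Type*} [TopologicalSpace α] (s : Set α) (ρ : α → α → ℝ)
    (u : α → ℝ) : Prop :=
  ∀ x ∈ s, ∃ K : ℝ, ∃ t ∈ nhdsWithin x s, ∀ y ∈ t ∩ s, ∀ z ∈ t ∩ s, |u y - u z| ≤ K * ρ y z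

/-- `u` is of class `C^{1,-}`: locally Lipschitz, with continuous local slope which
coincides with the lower local slope. -/
def IsC1MinusWrt {α : Type*} [TopologicalSpace α] (s : Set α) (ρ : α → α → ℝ)
    (u : α → ℝ) : Prop :=
  LocLipWrt s ρ u ∧ ContinuousOn (slopeWrt s ρ u) s ∧
    ∀ x ∈ s, lowerSlopeWrt s ρ u x = slopeWrt s ρ u x

/-- `u` is of class `C^{1,+}`: locally Lipschitz, with continuous local slope which
coincides with the upper local slope. -/
def IsC1PlusWrt {α : Type*} [TopologicalSpace α] (s : Set α) (ρ : α → α → ℝ)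
    (u : α → ℝ) : Prop :=
  LocLipWrt s ρ u ∧ ContinuousOn (slopeWrt s ρ u) s ∧
    ∀ x ∈ s, upperSlopeWrt s ρ u x = slopeWrt s ρ u x

/-- Upper semicontinuous envelope of `u` relative to `s`. -/
noncomputable def uscWrt {α : Type*} [TopologicalSpace α] (s : Set α) (u : α → ℝ) (x : α) : ℝ :=
  Filter.limsup u (nhdsWithin x s)

/-- Lower semicontinuous envelope of `u` relative to `s`. -/
noncomputable def lscWrt {α : Type*} [TopologicalSpace α] (s : Set α) (u : α → ℝ) (x : α) : ℝ :=
  Filter.liminf u (nhdsWithin x s)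

/-- `H_a(x,r,p) = inf { H x r q | q ≥ 0, |q - p| ≤ a }`. -/
noncomputable def Hlow {α : Type*} (H : α → ℝ → ℝ → ℝ) (a : ℝ) (x : α) (r p : ℝ) : ℝ :=
  sInf (H x r '' {q | 0 ≤ q ∧ |q - p| ≤ a})

/-- `H^a(x,r,p) = sup { H x r q | q ≥ 0, |q - p| ≤ a }`. -/
noncomputable def Hupp {α : Type*} (H : α → ℝ → ℝ → ℝ) (a : ℝ) (x : α) (r p : ℝ) : ℝ :=
  sSup (H x r '' {q | 0 ≤ q ∧ |q - p| ≤ a})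

/-- Metric viscosity subsolution of `H(x, u, |∇u|) = 0` on the space `(s, ρ)`. -/
def IsMVSubsolutionWrt {α : Type*} [TopologicalSpace α] (s : Set α) (ρ : α → α → ℝ)
    (H : α → ℝ → ℝ → ℝ) (u : α → ℝ) : Prop :=
  ∀ ψ₁ ψ₂ : α → ℝ, IsC1MinusWrt s ρ ψ₁ → LocLipWrt s ρ ψ₂ →
    ∀ x ∈ s, IsLocalMaxOn (fun y => uscWrt s u y - (ψ₁ y + ψ₂ y)) s x →
      Hlow H (uscWrt s (slopeWrt s ρ ψ₂) x) x (uscWrt s u x) (slopeWrt s ρ ψ₁ x) ≤ 0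

/-- Metric viscosity supersolution of `H(x, u, |∇u|) = 0` on the space `(s, ρ)`. -/
def IsMVSupersolutionWrt {α : Type*} [TopologicalSpace α] (s : Set α) (ρ : α → α → ℝ)
    (H : α → ℝ → ℝ → ℝ) (u : α → ℝ) : Prop :=
  ∀ ψ₁ ψ₂ : α → ℝ, IsC1PlusWrt s ρ ψ₁ → LocLipWrt s ρ ψ₂ →
    ∀ x ∈ s, IsLocalMinOn (fun y => lscWrt s u y - (ψ₁ y + ψ₂ y)) s x →
      0 ≤ Hupp H (uscWrt s (slopeWrt s ρ ψ₂) x) x (lscWrt s u x) (slopeWrt s ρ ψ₁ x)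

/-- `(s, ρ)` is a geodesic space: any two points are joined by an isometric
embedding of the interval `[0, ρ x y]`. -/
def IsGeodesicWrt {α : Type*} (s : Set α) (ρ : α → α → ℝ) : Prop :=
  ∀ x ∈ s, ∀ y ∈ s, ∃ γ : ℝ → α, γ 0 = x ∧ γ (ρ x y) = y ∧
    (∀ t ∈ Icc (0:ℝ) (ρ x y), γ t ∈ s) ∧
    ∀ t₁ ∈ Icc (0:ℝ) (ρ x y), ∀ t₂ ∈ Icc (0:ℝ) (ρ x y), ρ (γ t₁) (γ t₂) = |t₁ - t₂|

/-- Strict local maximum of `f` on `s` at `x`. -/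
def IsStrictLocalMaxOn' {α : Type*} [TopologicalSpace α] (f : α → ℝ) (s : Set α) (x : α) : Prop :=
  ∀ᶠ y in nhdsWithin x (s \ {x}), f y < f x

/-- Strict local minimum of `f` on `s` at `x`. -/
def IsStrictLocalMinOn' {α : Type*} [TopologicalSpace α] (f : α → ℝ) (s : Set α) (x : α) : Prop :=
  ∀ᶠ y in nhdsWithin x (s \ {x}), f x < f y

/-- `u` is locally bounded on `s`. -/
def LocBddWrt {α : Type*} [TopologicalSpace α] (s : Set α) (u : α → ℝ) : Prop :=
  ∀ x ∈ s, ∃ C : ℝ, ∀ᶠ y in nhdsWithin x s, |u y| ≤ C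

/-- `ρ` is a metric on the subset `S` of the ambient metric space `Y`, bounded below by the
ambient distance and inducing the subspace topology on `S`. -/
structure IsMetricOn {Y : Type*} [MetricSpace Y] (S : Set Y) (ρ : Y → Y → ℝ) : Prop where
  refl : ∀ x ∈ S, ρ x x = 0
  symm : ∀ x ∈ S, ∀ y ∈ S, ρ x y = ρ y x
  triangle : ∀ x ∈ S, ∀ y ∈ S, ∀ z ∈ S, ρ x z ≤ ρ x y + ρ y z
  ge_dist : ∀ x ∈ S, ∀ y ∈ S, dist x y ≤ ρ x y
  nhds_basis : ∀ x ∈ S, (nhdsWithin x S).HasBasis (fun ε : ℝ => 0 < ε)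
    (fun ε => {y | y ∈ S ∧ ρ x y < ε})

/-- Spatial local slope of `ψ : (0,∞) × X → ℝ` at `z = (t, x)`. -/
noncomputable def slopeSpWrt {α : Type*} [TopologicalSpace α] (s : Set α) (ρ : α → α → ℝ)
    (ψ : ℝ × α → ℝ) (z : ℝ × α) : ℝ :=
  Filter.limsup (fun y => |ψ (z.1, y) - ψ z| / ρ z.2 y) (nhdsWithin z.2 (s \ {z.2}))

/-- Spatial upper local slope. -/
noncomputable def upperSlopeSpWrt {α : Type*} [TopologicalSpace α] (s : Set α) (ρ : α → α → ℝ)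
    (ψ : ℝ × α → ℝ) (z : ℝ × α) : ℝ :=
  Filter.limsup (fun y => max (ψ (z.1, y) - ψ z) 0 / ρ z.2 y) (nhdsWithin z.2 (s \ {z.2}))

/-- Spatial lower local slope. -/
noncomputable def lowerSlopeSpWrt {α : Type*} [TopologicalSpace α] (s : Set α) (ρ : α → α → ℝ)
    (ψ : ℝ × α → ℝ) (z : ℝ × α) : ℝ :=
  Filter.limsup (fun y => max (ψ z - ψ (z.1, y)) 0 / ρ z.2 y) (nhdsWithin z.2 (s \ {z.2}))

/-- Product (max) metric on `ℝ × α` built from `ρ`. -/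
def prodMet {α : Type*} (ρ : α → α → ℝ) : ℝ × α → ℝ × α → ℝ :=
  fun z w => max |z.1 - w.1| (ρ z.2 w.2)

/-- Metric viscosity subsolution of `∂ₜ u + H(t, x, u, |∇u|) = 0` on `(0,∞) × (s, ρ)`. -/
def IsMVSubsolutionTWrt {α : Type*} [TopologicalSpace α] (s : Set α) (ρ : α → α → ℝ)
    (H : ℝ → α → ℝ → ℝ → ℝ) (u : ℝ × α → ℝ) : Prop :=
  ∀ ψ₁ ψ₂ dψ₁ dψ₂ : ℝ × α → ℝ,
    LocLipWrt (Ioi (0:ℝ) ×ˢ s) (prodMet ρ) ψ₁ →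
    LocLipWrt (Ioi (0:ℝ) ×ˢ s) (prodMet ρ) ψ₂ →
    (∀ z ∈ Ioi (0:ℝ) ×ˢ s, HasDerivAt (fun τ => ψ₁ (τ, z.2)) (dψ₁ z) z.1) →
    ContinuousOn dψ₁ (Ioi (0:ℝ) ×ˢ s) →
    (∀ z ∈ Ioi (0:ℝ) ×ˢ s, HasDerivAt (fun τ => ψ₂ (τ, z.2)) (dψ₂ z) z.1) →
    ContinuousOn dψ₂ (Ioi (0:ℝ) ×ˢ s) →
    ContinuousOn (slopeSpWrt s ρ ψ₁) (Ioi (0:ℝ) ×ˢ s) →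
    (∀ z ∈ Ioi (0:ℝ) ×ˢ s, lowerSlopeSpWrt s ρ ψ₁ z = slopeSpWrt s ρ ψ₁ z) →
    ∀ z ∈ Ioi (0:ℝ) ×ˢ s,
      IsLocalMaxOn (fun w => uscWrt (Ioi (0:ℝ) ×ˢ s) u w - (ψ₁ w + ψ₂ w))
        (Ioi (0:ℝ) ×ˢ s) z →
      dψ₁ z + dψ₂ z +
        Hlow (fun w : ℝ × α => H w.1 w.2)
          (uscWrt (Ioi (0:ℝ) ×ˢ s) (slopeSpWrt s ρ ψ₂) z) z
          (uscWrt (Ioi (0:ℝ) ×ˢ s) u z) (slopeSpWrt s ρ ψ₁ z) ≤ 0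

/-- Metric viscosity supersolution of `∂ₜ u + H(t, x, u, |∇u|) = 0` on `(0,∞) × (s, ρ)`. -/
def IsMVSupersolutionTWrt {α : Type*} [TopologicalSpace α] (s : Set α) (ρ : α → α → ℝ)
    (H : ℝ → α → ℝ → ℝ → ℝ) (u : ℝ × α → ℝ) : Prop :=
  ∀ ψ₁ ψ₂ dψ₁ dψ₂ : ℝ × α → ℝ,
    LocLipWrt (Ioi (0:ℝ) ×ˢ s) (prodMet ρ) ψ₁ →
    LocLipWrt (Ioi (0:ℝ) ×ˢ s) (prodMet ρ) ψ₂ →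
    (∀ z ∈ Ioi (0:ℝ) ×ˢ s, HasDerivAt (fun τ => ψ₁ (τ, z.2)) (dψ₁ z) z.1) →
    ContinuousOn dψ₁ (Ioi (0:ℝ) ×ˢ s) →
    (∀ z ∈ Ioi (0:ℝ) ×ˢ s, HasDerivAt (fun τ => ψ₂ (τ, z.2)) (dψ₂ z) z.1) →
    ContinuousOn dψ₂ (Ioi (0:ℝ) ×ˢ s) →
    ContinuousOn (slopeSpWrt s ρ ψ₁) (Ioi (0:ℝ) ×ˢ s) →
    (∀ z ∈ Ioi (0:ℝ) ×ˢ s, upperSlopeSpWrt s ρ ψ₁ z = slopeSpWrt s ρ ψ₁ z) →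
    ∀ z ∈ Ioi (0:ℝ) ×ˢ s,
      IsLocalMinOn (fun w => lscWrt (Ioi (0:ℝ) ×ˢ s) u w - (ψ₁ w + ψ₂ w))
        (Ioi (0:ℝ) ×ˢ s) z →
      0 ≤ dψ₁ z + dψ₂ z +
        Hupp (fun w : ℝ × α => H w.1 w.2)
          (uscWrt (Ioi (0:ℝ) ×ˢ s) (slopeSpWrt s ρ ψ₂) z) z
          (lscWrt (Ioi (0:ℝ) ×ˢ s) u z) (slopeSpWrt s ρ ψ₁ z)


/-- Convergence of pairs `(n, w)` with `w ∈ S n` to `(∞, z)`. -/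
def approxFilter {Z : Type*} [TopologicalSpace Z] (S : ℕ → Set Z) (z : Z) : Filter (ℕ × Z) :=
  (atTop ×ˢ 𝓝 z) ⊓ 𝓟 {q | q.2 ∈ S q.1}

theorem exists_seq_of_frequently_approxFilter {Z : Type*} [TopologicalSpace Z]
    [FirstCountableTopology Z] {S : ℕ → Set Z} {z : Z} {c : ℕ → Z} (hc : ∀ n, c n ∈ S n)
    (hcz : Tendsto c atTop (𝓝 z)) {P : ℕ × Z → Prop} (h : ∃ᶠ q in approxFilter S z, P q) :
    ∃ w : ℕ → Z, (∀ n, w n ∈ S n) ∧ Tendsto w atTop (𝓝 z) ∧ ∃ᶠ n in atTop, P (n, w n) := by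
  classical
  obtain ⟨q, hq, hqP⟩ := exists_seq_forall_of_frequently
    (frequently_inf_principal.1 h)
  have hq1 : Tendsto (fun k => (q k).1) atTop atTop := (tendsto_fst.comp hq)
  have hq2 : Tendsto (fun k => (q k).2) atTop (𝓝 z) := (tendsto_snd.comp hq)
  obtain ⟨φ, hφ, hmono⟩ := strictMono_subseq_of_tendsto_atTop hq1
  have hval : ∀ k, Function.extend (fun k => (q (φ k)).1) (fun k => (q (φ k)).2) c (q (φ k)).1
      = (q (φ k)).2 := fun k => hmono.injective.extend_apply _ _ k
  refine ⟨Function.extend (fun k => (q (φ k)).1) (fun k => (q (φ k)).2) c, ?_, ?_, ?_⟩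
  · intro n
    by_cases hn : ∃ k, (q (φ k)).1 = n
    · obtain ⟨k, rfl⟩ := hn
      rw [hval]
      exact (hqP (φ k)).1
    · rw [Function.extend_apply' _ _ _ hn]
      exact hc n
  · rw [tendsto_def]
    intro V hV
    have h1 := (hq2.comp hφ.tendsto_atTop) hV
    obtain ⟨k₀, hk₀⟩ := mem_atTop_sets.1 h1
    obtain ⟨m₀, hm₀⟩ := mem_atTop_sets.1 (hcz hV)
    refine mem_atTop_sets.2 ⟨max m₀ (q (φ k₀)).1, fun n hn => ?_⟩
    rw [mem_preimage]
    by_cases hnk : ∃ k, (q (φ k)).1 = n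
    · obtain ⟨k, rfl⟩ := hnk
      rw [hval]
      exact hk₀ k (hmono.le_iff_le.1 ((le_max_right _ _).trans hn))
    · rw [Function.extend_apply' _ _ _ hnk]
      exact hm₀ n ((le_max_left _ _).trans hn)
  · refine hmono.tendsto_atTop.frequently (Frequently.of_forall fun k => ?_)
    have := (hqP (φ k)).2
    simp only [Function.comp_apply, hval k]
    exact this

theorem tendsto_approxFilter {Z : Type*} [TopologicalSpace Z]
    [FirstCountableTopology Z] {S : ℕ → Set Z} {z : Z} {c : ℕ → Z} (hc : ∀ n, c n ∈ S n)
    (hcz : Tendsto c atTop (𝓝 z)) {f : ℕ → Z → ℝ} {L : ℝ}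
    (h : ∀ w : ℕ → Z, (∀ n, w n ∈ S n) → Tendsto w atTop (𝓝 z) →
      Tendsto (fun n => f n (w n)) atTop (𝓝 L)) :
    Tendsto (fun q : ℕ × Z => f q.1 q.2) (approxFilter S z) (𝓝 L) := by
  rw [tendsto_iff_forall_eventually_mem]
  intro V hV
  by_contra hcon
  obtain ⟨w, hw, hwz, hP⟩ := exists_seq_of_frequently_approxFilter
    (P := fun q => f q.1 q.2 ∉ V) hc hcz (not_eventually.1 hcon)
  exact hP ((tendsto_iff_forall_eventually_mem.1 (h w hw hwz) V hV).mono fun n hn => not_not.2 hn)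

theorem frequently_approxFilter_of_tendsto {Z : Type*} [TopologicalSpace Z] {S : ℕ → Set Z}
    {z : Z} {P : ℕ × Z → Prop} {q : ℕ → ℕ × Z} (h₁ : Tendsto (fun k => (q k).1) atTop atTop)
    (h₂ : Tendsto (fun k => (q k).2) atTop (𝓝 z)) (hS : ∀ k, (q k).2 ∈ S (q k).1)
    (hP : ∃ᶠ k in atTop, P (q k)) : ∃ᶠ q in approxFilter S z, P q := by
  have : Tendsto q atTop (approxFilter S z) :=
    tendsto_inf.2 ⟨h₁.prodMk h₂, tendsto_principal.2 (Eventually.of_forall hS)⟩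
  exact this.frequently hP

theorem tendsto_fst_approxFilter {Z : Type*} [TopologicalSpace Z] {S : ℕ → Set Z} {z : Z} :
    Tendsto Prod.fst (approxFilter S z) atTop := tendsto_fst.mono_left inf_le_left

theorem tendsto_snd_approxFilter {Z : Type*} [TopologicalSpace Z] {S : ℕ → Set Z} {z : Z} :
    Tendsto Prod.snd (approxFilter S z) (𝓝 z) := tendsto_snd.mono_left inf_le_left

theorem eventually_mem_approxFilter {Z : Type*} [TopologicalSpace Z] {S : ℕ → Set Z} {z : Z} :
    ∀ᶠ q in approxFilter S z, q.2 ∈ S q.1 :=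
  mem_inf_of_right (mem_principal_self _)

theorem exists_mem_approximants {Y : Type*} [MetricSpace Y] {X : ℕ → Set Y} {Xi : Set Y}
    (hXne : ∀ n, (X n).Nonempty) (hXc : ∀ n, IsCompact (X n)) (hXic : IsCompact Xi)
    (h1 : Tendsto (fun n => hausdorffDist (X n) Xi) atTop (𝓝 0)) {x : Y} (hx : x ∈ Xi) :
    ∃ c : ℕ → Y, (∀ n, c n ∈ X n) ∧ Tendsto c atTop (𝓝 x) := by
  choose c hc hcd using fun n => (hXc n).exists_infDist_eq_dist (hXne n) x
  refine ⟨c, hc, ?_⟩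
  rw [tendsto_iff_dist_tendsto_zero]
  refine squeeze_zero (fun _ => dist_nonneg) (fun n => ?_) h1
  rw [dist_comm, ← hcd n, hausdorffDist_comm]
  exact infDist_le_hausdorffDist_of_mem hx
    (hausdorffEDist_ne_top_of_nonempty_of_bounded ⟨x, hx⟩ (hXne n) hXic.isBounded
      (hXc n).isBounded)

/-- A bounded sequence of points of the approximating spaces clusters at a point of the limit. -/
theorem exists_frequently_approxFilter {Y : Type*} [MetricSpace Y] {X : ℕ → Set Y} {Xi : Set Y}
    (hXine : Xi.Nonempty) (hXc : ∀ n, IsCompact (X n)) (hXic : IsCompact Xi)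
    (h1 : Tendsto (fun n => hausdorffDist (X n) Xi) atTop (𝓝 0)) {z : ℝ × Y} {R : ℝ}
    (hR : R < z.1) {Q : ℕ → ℝ × Y → Prop}
    (h : ∃ᶠ n in atTop, ∃ w ∈ Ioi (0:ℝ) ×ˢ X n, dist w z ≤ R ∧ Q n w) :
    ∃ w₀ ∈ Ioi (0:ℝ) ×ˢ Xi, dist w₀ z ≤ R ∧
      ∃ᶠ q in approxFilter (fun n => Ioi (0:ℝ) ×ˢ X n) w₀, Q q.1 q.2 := by
  obtain ⟨φ, hφ, hφP⟩ := extraction_of_frequently_atTop h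
  choose w hwS hwR hwQ using hφP
  choose c hc hcd using fun n => hXic.exists_infDist_eq_dist hXine (w n).2
  have hlim : Tendsto (fun k => dist (w k).2 (c k)) atTop (𝓝 0) := by
    refine squeeze_zero (fun _ => dist_nonneg) (fun n => ?_) (h1.comp hφ.tendsto_atTop)
    rw [← hcd n]
    exact infDist_le_hausdorffDist_of_mem (hwS n).2
      (hausdorffEDist_ne_top_of_nonempty_of_bounded ⟨_, (hwS n).2⟩ hXine
        (hXc _).isBounded hXic.isBounded)
  have hcomp : IsCompact (closedBall z.1 R ×ˢ Xi) := (isCompact_closedBall _ _).prod hXic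
  obtain ⟨w₀, hw₀, ψ, hψ, hψl⟩ := hcomp.tendsto_subseq (x := fun k => ((w k).1, c k))
    (fun k => ⟨(le_max_left _ _).trans (hwR k), hc k⟩)
  have hl : Tendsto (fun k => w (ψ k)) atTop (𝓝 w₀) := by
    have ha : Tendsto (fun k => (w (ψ k)).1) atTop (𝓝 w₀.1) :=
      ((continuous_fst.tendsto w₀).comp hψl :)
    have hb : Tendsto (fun k => c (ψ k)) atTop (𝓝 w₀.2) :=
      ((continuous_snd.tendsto w₀).comp hψl :)
    refine ha.prodMk_nhds ?_
    rw [tendsto_iff_dist_tendsto_zero] at hb ⊢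
    refine squeeze_zero (fun _ => dist_nonneg) (fun n => dist_triangle _ (c (ψ n)) _) ?_
    simpa using (hlim.comp hψ.tendsto_atTop).add hb
  refine ⟨w₀, ⟨?_, hw₀.2⟩, ?_, ?_⟩
  · have := hw₀.1
    rw [mem_closedBall, Real.dist_eq, abs_le] at this
    rw [mem_Ioi]; linarith
  · exact le_of_tendsto (hl.dist tendsto_const_nhds) (Eventually.of_forall fun k => hwR _)
  · exact frequently_approxFilter_of_tendsto (q := fun k => (φ (ψ k), w (ψ k)))
      (hφ.tendsto_atTop.comp hψ.tendsto_atTop) hl (fun k => hwS _)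
      (Frequently.of_forall fun k => hwQ _)

theorem limsup_le_of_eventually_le_of_nonneg {α : Type*} {l : Filter α} {f : α → ℝ} {b : ℝ}
    (hb : 0 ≤ b) (h : ∀ᶠ x in l, f x ≤ b) : limsup f l ≤ b := by
  rw [limsup_eq]
  by_cases hB : BddBelow {a | ∀ᶠ n in l, f n ≤ a}
  · exact csInf_le hB h
  · rw [Real.sInf_of_not_bddBelow hB]; exact hb

theorem limsup_nonneg_of_eventually_nonneg {α : Type*} {l : Filter α} {f : α → ℝ}
    (h : ∀ᶠ x in l, 0 ≤ f x) : 0 ≤ limsup f l := by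
  rw [limsup_eq]
  rcases l.eq_or_neBot with rfl | hl
  · simp
  · refine Real.sInf_nonneg fun a ha => ?_
    obtain ⟨x, hx⟩ := (h.and ha).exists
    exact hx.1.trans hx.2

namespace IsMetricOn

variable {Y : Type*} [MetricSpace Y] {S : Set Y} {ρ : Y → Y → ℝ}

theorem nonneg (hm : IsMetricOn S ρ) {x y : Y} (hx : x ∈ S) (hy : y ∈ S) : 0 ≤ ρ x y :=
  dist_nonneg.trans (hm.ge_dist x hx y hy)

theorem pos (hm : IsMetricOn S ρ) {x y : Y} (hx : x ∈ S) (hy : y ∈ S) (h : x ≠ y) : 0 < ρ x y :=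
  (dist_pos.2 h).trans_le (hm.ge_dist x hx y hy)

theorem abs_sub_le (hm : IsMetricOn S ρ) {x x' y : Y} (hx : x ∈ S) (hx' : x' ∈ S) (hy : y ∈ S) :
    |ρ x y - ρ x' y| ≤ ρ x x' := by
  have h1 := hm.triangle x hx x' hx' y hy
  have h2 := hm.triangle x' hx' x hx y hy
  rw [hm.symm x' hx' x hx] at h2
  rw [abs_le]; constructor <;> linarith

theorem eventually_lt (hm : IsMetricOn S ρ) {x : Y} (hx : x ∈ S) {ε : ℝ} (hε : 0 < ε) :
    ∀ᶠ y in 𝓝[S] x, ρ x y < ε :=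
  mem_of_superset ((hm.nhds_basis x hx).mem_of_mem hε) fun _ hy => hy.2

theorem continuousOn (hm : IsMetricOn S ρ) {y : Y} (hy : y ∈ S) :
    ContinuousOn (fun x => ρ x y) S := by
  intro x hx
  rw [ContinuousWithinAt, Metric.tendsto_nhds]
  intro ε hε
  filter_upwards [hm.eventually_lt hx hε, self_mem_nhdsWithin] with x' h hx'
  rw [Real.dist_eq, abs_sub_comm]
  exact (hm.abs_sub_le hx hx' hy).trans_lt h

theorem slopeWrt_nonneg (hm : IsMetricOn S ρ) (f : Y → ℝ) {x : Y} (hx : x ∈ S) :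
    0 ≤ slopeWrt S ρ f x := by
  refine limsup_nonneg_of_eventually_nonneg ?_
  filter_upwards [self_mem_nhdsWithin] with y hy
  exact div_nonneg (abs_nonneg _) (hm.nonneg hx hy.1)

theorem slopeWrt_le (hm : IsMetricOn S ρ) {f : Y → ℝ} {x : Y} (hx : x ∈ S) {K : ℝ} (hK : 0 ≤ K)
    (h : ∀ᶠ y in 𝓝[S] x, |f y - f x| ≤ K * ρ x y) : slopeWrt S ρ f x ≤ K := by
  refine limsup_le_of_eventually_le_of_nonneg hK ?_
  filter_upwards [self_mem_nhdsWithin, h.filter_mono (nhdsWithin_mono x sdiff_subset)]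
    with y hy hy'
  exact (div_le_iff₀ (hm.pos hx hy.1 (Ne.symm hy.2))).2 hy'

theorem _root_.LocLipWrt.exists_eventually (hm : IsMetricOn S ρ) {f : Y → ℝ}
    (hf : LocLipWrt S ρ f) {x : Y} (hx : x ∈ S) :
    ∃ K, 0 ≤ K ∧ ∀ᶠ y in 𝓝[S] x, |f y - f x| ≤ K * ρ x y := by
  obtain ⟨K, t, ht, hK⟩ := hf x hx
  refine ⟨max K 0, le_max_right _ _, ?_⟩
  filter_upwards [ht, self_mem_nhdsWithin] with y hyt hy
  rw [abs_sub_comm]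
  exact (hK x ⟨mem_of_mem_nhdsWithin hx ht, hx⟩ y ⟨hyt, hy⟩).trans
    (mul_le_mul_of_nonneg_right (le_max_left _ _) (hm.nonneg hx hy))

theorem eventually_of_slopeWrt_lt (hm : IsMetricOn S ρ) {f : Y → ℝ} (hf : LocLipWrt S ρ f)
    {x : Y} (hx : x ∈ S) {L : ℝ} (h : slopeWrt S ρ f x < L) :
    ∀ᶠ y in 𝓝[S \ {x}] x, |f y - f x| < L * ρ x y := by
  obtain ⟨K, hK, hKe⟩ := hf.exists_eventually hm hx
  have hb : IsBoundedUnder (· ≤ ·) (𝓝[S \ {x}] x) (fun y => |f y - f x| / ρ x y) := by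
    refine ⟨K, eventually_map.2 ?_⟩
    filter_upwards [self_mem_nhdsWithin, hKe.filter_mono (nhdsWithin_mono x sdiff_subset)]
      with y hy hy'
    exact (div_le_iff₀ (hm.pos hx hy.1 (Ne.symm hy.2))).2 hy'
  filter_upwards [eventually_lt_of_limsup_lt h hb, self_mem_nhdsWithin] with y hy hyS
  exact (div_lt_iff₀ (hm.pos hx hyS.1 (Ne.symm hyS.2))).1 hy

/-- Points on a geodesic converge along the parameter. -/
theorem tendsto_geodesic (hm : IsMetricOn S ρ) {γ : ℝ → Y} {D : ℝ}
    (hγS : ∀ t ∈ Icc (0:ℝ) D, γ t ∈ S)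
    (hγ : ∀ t₁ ∈ Icc (0:ℝ) D, ∀ t₂ ∈ Icc (0:ℝ) D, ρ (γ t₁) (γ t₂) = |t₁ - t₂|)
    {s : ℝ} (hs : s ∈ Icc (0:ℝ) D) : Tendsto γ (𝓝[Icc 0 D] s) (𝓝[S] (γ s)) := by
  rw [(hm.nhds_basis _ (hγS s hs)).tendsto_right_iff]
  intro ε hε
  filter_upwards [self_mem_nhdsWithin, mem_nhdsWithin_of_mem_nhds (ball_mem_nhds s hε)]
    with t ht hts
  refine ⟨hγS t ht, ?_⟩
  rw [hγ s hs t ht, abs_sub_comm]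
  exact hts

theorem tendsto_geodesic_right (hm : IsMetricOn S ρ) {γ : ℝ → Y} {D : ℝ}
    (hγS : ∀ t ∈ Icc (0:ℝ) D, γ t ∈ S)
    (hγ : ∀ t₁ ∈ Icc (0:ℝ) D, ∀ t₂ ∈ Icc (0:ℝ) D, ρ (γ t₁) (γ t₂) = |t₁ - t₂|)
    {s : ℝ} (hs : s ∈ Ico (0:ℝ) D) : Tendsto γ (𝓝[>] s) (𝓝[S \ {γ s}] (γ s)) := by
  have hs' : s ∈ Icc (0:ℝ) D := ⟨hs.1, hs.2.le⟩
  have hmem : ∀ᶠ t in 𝓝[>] s, t ∈ Ioo s D := Ioo_mem_nhdsGT hs.2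
  have hle : 𝓝[>] s ≤ 𝓝[Icc 0 D] s := by
    rw [nhdsWithin]
    refine le_inf (nhdsWithin_le_nhds) (le_principal_iff.2 ?_)
    filter_upwards [hmem] with t ht
    exact ⟨hs.1.trans ht.1.le, ht.2.le⟩
  have h := (hm.tendsto_geodesic hγS hγ hs').mono_left hle
  refine tendsto_nhdsWithin_iff.2 ⟨h.mono_right nhdsWithin_le_nhds, ?_⟩
  filter_upwards [hmem] with t ht
  have htI : t ∈ Icc (0:ℝ) D := ⟨hs.1.trans ht.1.le, ht.2.le⟩
  refine ⟨hγS t htI, fun heq => ?_⟩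
  have h1 := hγ s hs' t htI
  rw [mem_singleton_iff] at heq
  rw [heq, hm.refl _ (hγS s hs'), eq_comm, abs_eq_zero, sub_eq_zero] at h1
  exact ht.1.ne h1

theorem continuousOn_of_locLipWrt (hm : IsMetricOn S ρ) {f : Y → ℝ} (hf : LocLipWrt S ρ f) :
    ContinuousOn f S := by
  intro x hx
  obtain ⟨K, hK, hKe⟩ := hf.exists_eventually hm hx
  rw [ContinuousWithinAt, Metric.tendsto_nhds]
  intro ε hε
  filter_upwards [hKe, hm.eventually_lt hx (ε := ε / (K + 1)) (by positivity),
    self_mem_nhdsWithin] with y h1 h2 hy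
  rw [lt_div_iff₀ (by positivity)] at h2
  rw [Real.dist_eq]
  have := hm.nonneg hx hy
  nlinarith

/-- A pointwise bound on the local slope gives a Lipschitz bound along geodesics. -/
theorem le_add_of_slopeWrt_le (hm : IsMetricOn S ρ) (hg : IsGeodesicWrt S ρ) {f : Y → ℝ}
    (hf : LocLipWrt S ρ f) {x₀ : Y} (hx₀ : x₀ ∈ S) {r L : ℝ}
    (hs : ∀ x ∈ S, ρ x₀ x < r → slopeWrt S ρ f x ≤ L) {x y : Y} (hx : x ∈ S) (hy : y ∈ S)
    (hxr : ρ x₀ x < r / 3) (hyr : ρ x₀ y < r / 3) : f x ≤ f y + L * ρ x y := by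
  obtain ⟨γ, hγ0, hγ1, hγS, hγ⟩ := hg y hy x hx
  set D := ρ y x with hD
  have hD0 : 0 ≤ D := hm.nonneg hy hx
  have hnear : ∀ s ∈ Icc (0:ℝ) D, ρ x₀ (γ s) < r := by
    intro s hsI
    have h1 := hm.triangle x₀ hx₀ y hy (γ s) (hγS s hsI)
    have h2 : ρ y (γ s) = s := by
      conv_lhs => rw [← hγ0]
      rw [hγ 0 ⟨le_rfl, hD0⟩ s hsI, zero_sub, abs_neg, abs_of_nonneg hsI.1]
    have h3 := hm.triangle y hy x₀ hx₀ x hx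
    rw [hm.symm y hy x₀ hx₀, ← hD] at h3
    linarith [hsI.2]
  have key := image_le_of_liminf_slope_right_le_deriv_boundary (f := f ∘ γ) (a := 0) (b := D)
    (B := fun s => f y + L * s) (B' := fun _ => L) ?_ (by simp [hγ0]) ?_ ?_ ?_
      (right_mem_Icc.2 hD0)
  · simpa [hγ1, hm.symm x hx y hy] using key
  · intro s hsI
    exact ((hm.continuousOn_of_locLipWrt hf _ (hγS s hsI)).tendsto).comp
      (hm.tendsto_geodesic hγS hγ hsI)
  · fun_prop
  · intro s _
    simpa using (((hasDerivAt_id s).const_mul L).const_add (f y)).hasDerivWithinAt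
  · intro s hsI c hc
    have hsI' : s ∈ Icc (0:ℝ) D := ⟨hsI.1, hsI.2.le⟩
    have h1 := (hm.tendsto_geodesic_right hγS hγ hsI).eventually
      (hm.eventually_of_slopeWrt_lt hf (hγS s hsI')
        ((hs _ (hγS s hsI') (hnear s hsI')).trans_lt hc))
    refine Eventually.frequently ?_
    filter_upwards [h1, Ioo_mem_nhdsGT hsI.2] with t ht htI
    have htI' : t ∈ Icc (0:ℝ) D := ⟨hsI.1.trans htI.1.le, htI.2.le⟩
    rw [hγ s hsI' t htI', abs_sub_comm s t, abs_of_pos (sub_pos.2 htI.1)] at ht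
    rw [slope_def_field, div_lt_iff₀ (sub_pos.2 htI.1)]
    exact (le_abs_self _).trans_lt ht

theorem mul_sq_slopeWrt (hm : IsMetricOn S ρ) (hg : IsGeodesicWrt S ρ) {κ : ℝ} (hκ : 0 ≤ κ)
    {y : Y} (hy : y ∈ S) (c : ℝ) {x : Y} (hx : x ∈ S) :
    slopeWrt S ρ (fun x => c + κ * ρ x y ^ 2) x = 2 * κ * ρ x y ∧
      lowerSlopeWrt S ρ (fun x => c + κ * ρ x y ^ 2) x = 2 * κ * ρ x y := by
  have hD0 := hm.nonneg hx hy
  have hquot : ∀ ε > 0, ∀ᶠ x' in 𝓝[S \ {x}] x,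
      |(c + κ * ρ x' y ^ 2) - (c + κ * ρ x y ^ 2)| / ρ x x' ≤ 2 * κ * ρ x y + ε := by
    intro ε hε
    filter_upwards [self_mem_nhdsWithin, (hm.eventually_lt hx (ε := ε / (κ + 1))
      (by positivity)).filter_mono (nhdsWithin_mono x sdiff_subset)] with x' hx' hlt
    have hpos := hm.pos hx hx'.1 (Ne.symm hx'.2)
    rw [div_le_iff₀ hpos]
    have h1 := hm.abs_sub_le hx hx'.1 hy
    have h2 := hm.nonneg hx'.1 hy
    have h3 : (c + κ * ρ x' y ^ 2) - (c + κ * ρ x y ^ 2)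
        = (κ * (ρ x y + ρ x' y)) * -(ρ x y - ρ x' y) := by ring
    rw [h3, abs_mul, abs_neg, abs_of_nonneg (by positivity)]
    refine mul_le_mul ?_ h1 (abs_nonneg _) (by positivity)
    rw [lt_div_iff₀ (by positivity)] at hlt
    have h4 := (abs_le.1 h1).1
    nlinarith
  have hle : slopeWrt S ρ (fun x => c + κ * ρ x y ^ 2) x ≤ 2 * κ * ρ x y :=
    le_of_forall_pos_le_add fun ε hε =>
      limsup_le_of_eventually_le_of_nonneg (by positivity) (hquot ε hε)
  have hmono : ∀ᶠ x' in 𝓝[S \ {x}] x,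
      max ((c + κ * ρ x y ^ 2) - (c + κ * ρ x' y ^ 2)) 0 / ρ x x' ≤
        |(c + κ * ρ x' y ^ 2) - (c + κ * ρ x y ^ 2)| / ρ x x' := by
    filter_upwards [self_mem_nhdsWithin] with x' hx'
    refine div_le_div_of_nonneg_right (max_le ?_ (abs_nonneg _)) (hm.nonneg hx hx'.1)
    rw [abs_sub_comm]
    exact le_abs_self _
  have hle' : lowerSlopeWrt S ρ (fun x => c + κ * ρ x y ^ 2) x ≤ 2 * κ * ρ x y := by
    refine le_of_forall_pos_le_add fun ε hε =>
      limsup_le_of_eventually_le_of_nonneg (by positivity) ?_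
    filter_upwards [hmono, hquot ε hε] with x' h1 h2 using h1.trans h2
  have hge : 2 * κ * ρ x y ≤ lowerSlopeWrt S ρ (fun x => c + κ * ρ x y ^ 2) x := by
    by_cases hxy : x = y
    · rw [hxy, hm.refl y hy, mul_zero, ← hxy]
      refine limsup_nonneg_of_eventually_nonneg ?_
      filter_upwards [self_mem_nhdsWithin] with x' hx'
      exact div_nonneg (le_max_right _ _) (hm.nonneg hx hx'.1)
    obtain ⟨γ, hγ0, hγ1, hγS, hγ⟩ := hg x hx y hy
    set D := ρ x y with hD
    have hDpos : 0 < D := hm.pos hx hy hxy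
    refine le_of_forall_pos_sub_le fun ε hε => ?_
    refine le_limsup_of_frequently_le ?_ ?_
    · have ht := hm.tendsto_geodesic_right hγS hγ (s := 0) ⟨le_rfl, hDpos⟩
      rw [hγ0] at ht
      refine ht.frequently (Eventually.frequently ?_)
      have hlt : (0:ℝ) < min D (ε / (κ + 1)) := lt_min hDpos (by positivity)
      filter_upwards [Ioo_mem_nhdsGT hlt] with s hs
      have hsD : s < D := hs.2.trans_le (min_le_left _ _)
      have hsε : s * (κ + 1) < ε := (lt_div_iff₀ (by positivity)).1
        (hs.2.trans_le (min_le_right _ _))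
      have hsI : s ∈ Icc (0:ℝ) D := ⟨hs.1.le, hsD.le⟩
      have e1 : ρ x (γ s) = s := by
        conv_lhs => rw [← hγ0]
        rw [hγ 0 ⟨le_rfl, hD0⟩ s hsI, zero_sub, abs_neg, abs_of_pos hs.1]
      have e2 : ρ (γ s) y = D - s := by
        conv_lhs => rw [← hγ1]
        rw [hγ s hsI D ⟨hD0, le_rfl⟩, abs_sub_comm, abs_of_pos (sub_pos.2 hsD)]
      rw [e1, e2, le_div_iff₀ hs.1]
      refine le_trans ?_ (le_max_left _ _)
      have : 0 < s := hs.1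
      nlinarith
    · refine ⟨2 * κ * D + 1, eventually_map.2 ?_⟩
      filter_upwards [hmono, hquot 1 one_pos] with x' h1 h2 using h1.trans h2
  refine ⟨le_antisymm hle ?_, le_antisymm hle' hge⟩
  refine hge.trans ?_
  rcases (𝓝[S \ {x}] x).eq_or_neBot with hbot | hne
  · simp [lowerSlopeWrt, slopeWrt, hbot, limsup_eq]
  · refine limsup_le_limsup hmono ?_ ?_
    · refine IsBoundedUnder.isCoboundedUnder_le ⟨0, eventually_map.2 ?_⟩
      filter_upwards [self_mem_nhdsWithin] with x' hx'
      exact div_nonneg (le_max_right _ _) (hm.nonneg hx hx'.1)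
    · exact ⟨_, eventually_map.2 (hquot 1 one_pos)⟩

end IsMetricOn

section Envelope

variable {α : Type*} [TopologicalSpace α] {s : Set α} {u : α → ℝ} {C : ℝ} {x : α}

theorem eventually_lt_of_uscWrt_lt (hC : ∀ᶠ y in 𝓝[s] x, u y ≤ C) {c : ℝ}
    (h : uscWrt s u x < c) : ∀ᶠ y in 𝓝[s] x, u y < c :=
  eventually_lt_of_limsup_lt h ⟨C, eventually_map.2 hC⟩

theorem le_uscWrt (hC : ∀ y ∈ s, u y ≤ C) (hx : x ∈ s) : u x ≤ uscWrt s u x := by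
  refine le_limsup_of_frequently_le ?_ ⟨C, eventually_map.2 ?_⟩
  · rw [Filter.Frequently]
    intro h
    exact mem_of_mem_nhdsWithin hx h le_rfl
  · filter_upwards [self_mem_nhdsWithin] with y hy using hC y hy

theorem uscWrt_le (hC : ∀ y ∈ s, C ≤ u y) (hx : x ∈ s) {c : ℝ} (h : ∀ᶠ y in 𝓝[s] x, u y ≤ c) :
    uscWrt s u x ≤ c := by
  have : (𝓝[s] x).NeBot := mem_closure_iff_nhdsWithin_neBot.1 (subset_closure hx)
  refine limsup_le_of_le (IsBoundedUnder.isCoboundedUnder_le ⟨C, eventually_map.2 ?_⟩) h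
  filter_upwards [self_mem_nhdsWithin] with y hy using hC y hy

theorem upperSemicontinuousOn_uscWrt (hC : ∀ y ∈ s, |u y| ≤ C) :
    UpperSemicontinuousOn (uscWrt s u) s := by
  intro x hx c hc
  obtain ⟨c', h1, h2⟩ := exists_between hc
  have h3 : ∀ᶠ y in 𝓝[s] x, u y < c' := eventually_lt_of_uscWrt_lt (C := C)
    (by filter_upwards [self_mem_nhdsWithin] with y hy using (abs_le.1 (hC y hy)).2) h1
  filter_upwards [eventually_eventually_nhdsWithin.2 h3, self_mem_nhdsWithin] with y hy hys
  exact (uscWrt_le (C := -C) (fun y hy => (abs_le.1 (hC y hy)).1) hys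
    (hy.mono fun _ h => h.le)).trans_lt h2

end Envelope

namespace IsMetricOn

variable {Y : Type*} [MetricSpace Y] {S : Set Y} {ρ : Y → Y → ℝ}

theorem tendsto_snd_nhdsWithin {T : Set ℝ} (z : ℝ × Y) :
    Tendsto Prod.snd (𝓝[T ×ˢ S] z) (𝓝[S] z.2) := by
  rw [← Prod.mk.eta (p := z), nhdsWithin_prod_eq]
  exact tendsto_snd

theorem tendsto_fst_nhdsWithin {T : Set ℝ} (z : ℝ × Y) :
    Tendsto Prod.fst (𝓝[T ×ˢ S] z) (𝓝[T] z.1) := by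
  rw [← Prod.mk.eta (p := z), nhdsWithin_prod_eq]
  exact tendsto_fst

theorem tendsto_mk_nhdsWithin {T : Set ℝ} {t : ℝ} (ht : t ∈ T) (x : Y) :
    Tendsto (fun y => (t, y)) (𝓝[S] x) (𝓝[T ×ˢ S] (t, x)) := by
  rw [nhdsWithin_prod_eq]
  exact (tendsto_nhdsWithin_iff.2 ⟨tendsto_const_nhds, Eventually.of_forall fun _ => ht⟩).prodMk
    tendsto_id

theorem locLipWrt_section (hm : IsMetricOn S ρ) {T : Set ℝ} {ψ : ℝ × Y → ℝ}
    (hψ : LocLipWrt (T ×ˢ S) (prodMet ρ) ψ) {t : ℝ} (ht : t ∈ T) :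
    LocLipWrt S ρ (fun x => ψ (t, x)) := by
  intro x hx
  obtain ⟨K, U, hU, hK⟩ := hψ (t, x) ⟨ht, hx⟩
  refine ⟨K, _, tendsto_mk_nhdsWithin ht x hU, fun y hy z hz => ?_⟩
  have := hK (t, y) ⟨hy.1, ht, hy.2⟩ (t, z) ⟨hz.1, ht, hz.2⟩
  simpa [prodMet, hm.nonneg hy.2 hz.2] using this

theorem locLipWrt_quadratic (hm : IsMetricOn S ρ) (T : Set ℝ) {y : Y} (hy : y ∈ S)
    (A B τ : ℝ) {κ : ℝ} (hκ : 0 ≤ κ) : LocLipWrt (T ×ˢ S) (prodMet ρ)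
      (fun w => A * (w.1 - τ) + B * (w.1 - τ) ^ 2 + κ * ρ w.2 y ^ 2) := by
  intro z hz
  refine ⟨|A| + |B| * (2 * |z.1 - τ| + 2) + κ * (2 * ρ z.2 y + 2),
    {w | |w.1 - z.1| < 1 ∧ ρ z.2 w.2 < 1}, ?_, ?_⟩
  · have h1 : ∀ᶠ w in 𝓝[T ×ˢ S] z, |w.1 - z.1| < 1 :=
      (tendsto_fst_nhdsWithin z).eventually
        (mem_nhdsWithin_of_mem_nhds (ball_mem_nhds z.1 one_pos))
    filter_upwards [h1, (tendsto_snd_nhdsWithin z).eventually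
      (hm.eventually_lt hz.2 one_pos)] with w h2 h3 using ⟨h2, h3⟩
  · rintro v ⟨⟨hv1, hv2⟩, -, hvS⟩ w ⟨⟨hw1, hw2⟩, -, hwS⟩
    have hr : ∀ x ∈ S, ρ z.2 x < 1 → ρ x y ≤ ρ z.2 y + 1 := by
      intro x hx h
      have h' := hm.abs_sub_le hz.2 hx hy
      linarith [(abs_le.1 h').1]
    have ht : ∀ s : ℝ, |s - z.1| < 1 → |s - τ| ≤ |z.1 - τ| + 1 := by
      intro s h
      have := abs_add_le (s - z.1) (z.1 - τ)
      rw [sub_add_sub_cancel] at this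
      linarith
    have hm1 : |v.1 - w.1| ≤ prodMet ρ v w := le_max_left _ _
    have hm2 : ρ v.2 w.2 ≤ prodMet ρ v w := le_max_right _ _
    have e1 : |A * (v.1 - τ) - A * (w.1 - τ)| ≤ |A| * prodMet ρ v w := by
      rw [← mul_sub, abs_mul, sub_sub_sub_cancel_right]
      exact mul_le_mul_of_nonneg_left hm1 (abs_nonneg _)
    have e2 : |B * (v.1 - τ) ^ 2 - B * (w.1 - τ) ^ 2|
        ≤ |B| * (2 * |z.1 - τ| + 2) * prodMet ρ v w := by
      have : B * (v.1 - τ) ^ 2 - B * (w.1 - τ) ^ 2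
          = B * ((v.1 - τ) + (w.1 - τ)) * (v.1 - w.1) := by ring
      rw [this, abs_mul, abs_mul]
      refine mul_le_mul (mul_le_mul_of_nonneg_left ?_ (abs_nonneg _)) hm1 (abs_nonneg _)
        (by positivity)
      linarith [abs_add_le (v.1 - τ) (w.1 - τ), ht _ hv1, ht _ hw1]
    have e3 : |κ * ρ v.2 y ^ 2 - κ * ρ w.2 y ^ 2| ≤ κ * (2 * ρ z.2 y + 2) * prodMet ρ v w := by
      have : κ * ρ v.2 y ^ 2 - κ * ρ w.2 y ^ 2
          = κ * (ρ v.2 y + ρ w.2 y) * (ρ v.2 y - ρ w.2 y) := by ring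
      have n1 := hm.nonneg hvS hy
      have n2 := hm.nonneg hwS hy
      have n3 := hm.nonneg hz.2 hy
      rw [this, abs_mul, abs_of_nonneg (by positivity)]
      refine mul_le_mul (mul_le_mul_of_nonneg_left ?_ hκ) ((hm.abs_sub_le hvS hwS hy).trans hm2)
        (abs_nonneg _) (by positivity)
      linarith [hr _ hvS hv2, hr _ hwS hw2]
    calc _ = |(A * (v.1 - τ) - A * (w.1 - τ)) + (B * (v.1 - τ) ^ 2 - B * (w.1 - τ) ^ 2)
          + (κ * ρ v.2 y ^ 2 - κ * ρ w.2 y ^ 2)| := by congr 1; ring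
      _ ≤ _ := (abs_add_three _ _ _).trans (by linarith)

theorem locLipWrt_dist (hm : IsMetricOn S ρ) (T : Set ℝ) {y : Y} (hy : y ∈ S)
    {b : ℝ} (hb : 0 ≤ b) : LocLipWrt (T ×ˢ S) (prodMet ρ) (fun w => b * ρ w.2 y) := by
  intro z _
  refine ⟨b, univ, univ_mem, fun v hv w hw => ?_⟩
  rw [← mul_sub, abs_mul, abs_of_nonneg hb]
  exact mul_le_mul_of_nonneg_left ((hm.abs_sub_le hv.2.2 hw.2.2 hy).trans (le_max_right _ _)) hb

/-- A subsolution tested with a quadratic in time, the squared distance to a point and a multiple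
of the distance to another point. -/
theorem exists_of_isMVSubsolutionTWrt (hm : IsMetricOn S ρ) (hg : IsGeodesicWrt S ρ)
    {H : ℝ → Y → ℝ → ℝ → ℝ} {u : ℝ × Y → ℝ} (hsub : IsMVSubsolutionTWrt S ρ H u)
    {x₀ y : Y} (hx₀ : x₀ ∈ S) (hy : y ∈ S) {A B τ κ b : ℝ} (hκ : 0 ≤ κ) (hb : 0 ≤ b)
    {z : ℝ × Y} (hz : z ∈ Ioi (0:ℝ) ×ˢ S)
    (hmax : IsLocalMaxOn (fun w => uscWrt (Ioi (0:ℝ) ×ˢ S) u w -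
      (A * (w.1 - τ) + B * (w.1 - τ) ^ 2 + κ * ρ w.2 y ^ 2 + b * ρ w.2 x₀)) (Ioi (0:ℝ) ×ˢ S) z)
    {θ : ℝ} (hθ : 0 < θ) :
    ∃ q, 0 ≤ q ∧ |q - 2 * κ * ρ z.2 y| ≤ b ∧
      A + 2 * B * (z.1 - τ) + H z.1 z.2 (uscWrt (Ioi (0:ℝ) ×ˢ S) u z) q < θ := by
  set ψ₁ : ℝ × Y → ℝ := fun w => A * (w.1 - τ) + B * (w.1 - τ) ^ 2 + κ * ρ w.2 y ^ 2 with hψ₁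
  set ψ₂ : ℝ × Y → ℝ := fun w => b * ρ w.2 x₀ with hψ₂
  have hs1 : ∀ w ∈ Ioi (0:ℝ) ×ˢ S, slopeSpWrt S ρ ψ₁ w = 2 * κ * ρ w.2 y :=
    fun w hw => (hm.mul_sq_slopeWrt hg hκ hy (A * (w.1 - τ) + B * (w.1 - τ) ^ 2) hw.2).1
  have hs1' : ∀ w ∈ Ioi (0:ℝ) ×ˢ S, lowerSlopeSpWrt S ρ ψ₁ w = 2 * κ * ρ w.2 y :=
    fun w hw => (hm.mul_sq_slopeWrt hg hκ hy (A * (w.1 - τ) + B * (w.1 - τ) ^ 2) hw.2).2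
  have hs2 : ∀ w ∈ Ioi (0:ℝ) ×ˢ S, slopeSpWrt S ρ ψ₂ w ≤ b := by
    intro w hw
    refine hm.slopeWrt_le (f := fun x => b * ρ x x₀) hw.2 hb ?_
    filter_upwards [self_mem_nhdsWithin] with x hx
    rw [← mul_sub, abs_mul, abs_of_nonneg hb, abs_sub_comm]
    exact mul_le_mul_of_nonneg_left (hm.abs_sub_le hw.2 hx hx₀) hb
  have ha : uscWrt (Ioi (0:ℝ) ×ˢ S) (slopeSpWrt S ρ ψ₂) z ≤ b := by
    refine limsup_le_of_eventually_le_of_nonneg hb ?_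
    filter_upwards [self_mem_nhdsWithin] with w hw using hs2 w hw
  have ha0 : 0 ≤ uscWrt (Ioi (0:ℝ) ×ˢ S) (slopeSpWrt S ρ ψ₂) z := by
    refine limsup_nonneg_of_eventually_nonneg ?_
    filter_upwards [self_mem_nhdsWithin] with w hw
    exact hm.slopeWrt_nonneg (fun x => b * ρ x x₀) hw.2
  have key := hsub ψ₁ ψ₂ (fun w => A + 2 * B * (w.1 - τ)) (fun _ => 0)
    (hm.locLipWrt_quadratic _ hy A B τ hκ) (hm.locLipWrt_dist _ hx₀ hb) ?_ (by fun_prop) ?_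
    continuousOn_const ?_ (fun w hw => (hs1' w hw).trans (hs1 w hw).symm) z hz hmax
  · rw [hs1 z hz] at key
    have hne : ((fun w : ℝ × Y => H w.1 w.2) z (uscWrt (Ioi (0:ℝ) ×ˢ S) u z) ''
        {q | 0 ≤ q ∧ |q - 2 * κ * ρ z.2 y| ≤
          uscWrt (Ioi (0:ℝ) ×ˢ S) (slopeSpWrt S ρ ψ₂) z}).Nonempty := by
      refine Set.Nonempty.image _ ⟨2 * κ * ρ z.2 y, ?_, by simpa using ha0⟩
      have := hm.nonneg hz.2 hy
      positivity
    obtain ⟨_, ⟨q, ⟨hq0, hq⟩, rfl⟩, hlt⟩ := exists_lt_of_csInf_lt hne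
      (b := θ - (A + 2 * B * (z.1 - τ))) (by
        have : sInf _ ≤ _ := le_sub_iff_add_le'.2 key
        refine this.trans_lt ?_
        linarith)
    exact ⟨q, hq0, hq.trans ha, by linarith⟩
  · intro w _
    have h : HasDerivAt (fun t : ℝ => t - τ) 1 w.1 := (hasDerivAt_id w.1).sub_const τ
    have h' := ((h.const_mul A).add ((h.pow 2).const_mul B)).add_const (κ * ρ w.2 y ^ 2)
    refine h'.congr_deriv ?_
    simp; ring
  · intro w _
    exact hasDerivAt_const w.1 (b * ρ w.2 x₀)
  · refine ContinuousOn.congr (f := fun w : ℝ × Y => 2 * κ * ρ w.2 y) ?_ hs1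
    exact continuousOn_const.mul ((hm.continuousOn hy).comp continuousOn_snd fun w hw => hw.2)

/-- First-order upper expansion in time, uniformly in space. -/
theorem exists_time_bound {ψ dψ : ℝ × Y → ℝ}
    (hd : ∀ z ∈ Ioi (0:ℝ) ×ˢ S, HasDerivAt (fun τ => ψ (τ, z.2)) (dψ z) z.1)
    (hc : ContinuousOn dψ (Ioi (0:ℝ) ×ˢ S)) {z : ℝ × Y} (hz : z ∈ Ioi (0:ℝ) ×ˢ S)
    {ε : ℝ} (hε : 0 < ε) : ∃ R > 0, ∀ w ∈ Ioi (0:ℝ) ×ˢ S, dist w z ≤ R →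
      ψ w ≤ ψ (z.1, w.2) + dψ z * (w.1 - z.1) + ε * |w.1 - z.1| := by
  have h1 : ∀ᶠ w in 𝓝[Ioi (0:ℝ) ×ˢ S] z, dist (dψ w) (dψ z) < ε :=
    Metric.tendsto_nhds.1 (hc z hz) ε hε
  obtain ⟨R, hR, hRs⟩ := Metric.mem_nhdsWithin_iff.1 h1
  refine ⟨R / 2, half_pos hR, fun w hw hwR => ?_⟩
  have hwR' : |w.1 - z.1| ≤ R / 2 := (le_max_left _ _).trans hwR
  have hwR2 : dist w.2 z.2 ≤ R / 2 := (le_max_right _ _).trans hwR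
  have hmem : ∀ t ∈ uIcc z.1 w.1, (t, w.2) ∈ Ioi (0:ℝ) ×ˢ S ∧ |dψ (t, w.2) - dψ z| ≤ ε := by
    intro t ht
    have ht0 : (t, w.2) ∈ Ioi (0:ℝ) ×ˢ S := by
      refine ⟨?_, hw.2⟩
      have := ht.1
      exact lt_of_lt_of_le (lt_min hz.1 hw.1) this
    refine ⟨ht0, (hRs ⟨?_, ht0⟩ : dist _ _ < ε).le⟩
    have : |t - z.1| ≤ |w.1 - z.1| := abs_sub_left_of_mem_uIcc ht
    refine max_lt ?_ (lt_of_le_of_lt hwR2 (by linarith))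
    exact lt_of_le_of_lt this (by linarith)
  have key := (convex_uIcc z.1 w.1).norm_image_sub_le_of_norm_hasDerivWithin_le
    (f := fun t => ψ (t, w.2) - dψ z * t) (f' := fun t => dψ (t, w.2) - dψ z * 1) (C := ε)
    (fun t ht => ((hd (t, w.2) (hmem t ht).1).sub
      ((hasDerivAt_id t).const_mul (dψ z))).hasDerivWithinAt)
    (fun t ht => by simpa using (hmem t ht).2) left_mem_uIcc right_mem_uIcc
  have := (abs_le.1 key).2
  simp only [Prod.mk.eta, Real.norm_eq_abs] at this
  linarith

/-- An eventual bound on the slope gives a Lipschitz bound on a small ball. -/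
theorem exists_space_bound (hm : IsMetricOn S ρ) (hg : IsGeodesicWrt S ρ) {f : Y → ℝ}
    (hf : LocLipWrt S ρ f) {x₀ : Y} (hx₀ : x₀ ∈ S) {L : ℝ}
    (h : ∀ᶠ x in 𝓝[S] x₀, slopeWrt S ρ f x ≤ L) :
    ∃ r > 0, ∀ x ∈ S, ∀ y ∈ S, ρ x₀ x < r → ρ x₀ y < r → f x ≤ f y + L * ρ x y := by
  obtain ⟨r, hr, hrs⟩ := (hm.nhds_basis x₀ hx₀).mem_iff.1 h
  exact ⟨r / 3, by positivity, fun x hx y hy hxr hyr =>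
    hm.le_add_of_slopeWrt_le hg hf hx₀ (fun x hx h => hrs ⟨hx, h⟩) hx hy hxr hyr⟩

theorem frequently_descent (hm : IsMetricOn S ρ) {f : Y → ℝ} {x₀ : Y} (hx₀ : x₀ ∈ S) {c : ℝ}
    (hc : 0 ≤ c) (h : c < lowerSlopeWrt S ρ f x₀) :
    ∃ᶠ y in 𝓝[S \ {x₀}] x₀, c * ρ x₀ y < f x₀ - f y := by
  intro hcon
  refine h.not_ge (limsup_le_of_eventually_le_of_nonneg hc ?_)
  filter_upwards [hcon, self_mem_nhdsWithin] with y hy hyS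
  have hpos := hm.pos hx₀ hyS.1 (Ne.symm hyS.2)
  rw [div_le_iff₀ hpos]
  exact max_le (not_lt.1 hy) (by positivity)

theorem eventually_slopeSpWrt_lt (hm : IsMetricOn S ρ) {ψ : ℝ × Y → ℝ}
    (hψ : LocLipWrt (Ioi (0:ℝ) ×ˢ S) (prodMet ρ) ψ) {z : ℝ × Y} (hz : z ∈ Ioi (0:ℝ) ×ˢ S) {c : ℝ}
    (h : uscWrt (Ioi (0:ℝ) ×ˢ S) (slopeSpWrt S ρ ψ) z < c) :
    ∀ᶠ w in 𝓝[Ioi (0:ℝ) ×ˢ S] z, slopeSpWrt S ρ ψ w < c := by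
  obtain ⟨K, U, hU, hK⟩ := hψ z hz
  refine eventually_lt_of_uscWrt_lt (C := max K 0) ?_ h
  filter_upwards [eventually_eventually_nhdsWithin.2 hU, hU, self_mem_nhdsWithin] with w hw hwU hwS
  refine hm.slopeWrt_le (f := fun x => ψ (w.1, x)) hwS.2 (le_max_right _ _) ?_
  filter_upwards [tendsto_mk_nhdsWithin hwS.1 w.2 |>.eventually hw, self_mem_nhdsWithin]
    with x hx hxS
  have h1 := hK w ⟨hwU, hwS⟩ (w.1, x) ⟨hx, hwS.1, hxS⟩
  have h2 := hm.nonneg hwS.2 hxS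
  simp only [prodMet, sub_self, abs_zero, max_eq_right h2] at h1
  rw [abs_sub_comm]
  exact h1.trans (mul_le_mul_of_nonneg_right (le_max_left _ _) h2)

end IsMetricOn

namespace IsMetricOn

variable {Y : Type*} [MetricSpace Y] {S : Set Y} {ρ : Y → Y → ℝ}

/-- Near a point, a test function lies below a quadratic in time plus a squared distance to a
nearby point plus a multiple of the distance, up to a small error. -/
theorem exists_model_bound (hm : IsMetricOn S ρ) (hg : IsGeodesicWrt S ρ)
    {ψ₁ ψ₂ dψ₁ dψ₂ : ℝ × Y → ℝ}
    (h₁ : LocLipWrt (Ioi (0:ℝ) ×ˢ S) (prodMet ρ) ψ₁)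
    (h₂ : LocLipWrt (Ioi (0:ℝ) ×ˢ S) (prodMet ρ) ψ₂)
    (hd₁ : ∀ z ∈ Ioi (0:ℝ) ×ˢ S, HasDerivAt (fun τ => ψ₁ (τ, z.2)) (dψ₁ z) z.1)
    (hc₁ : ContinuousOn dψ₁ (Ioi (0:ℝ) ×ˢ S))
    (hd₂ : ∀ z ∈ Ioi (0:ℝ) ×ˢ S, HasDerivAt (fun τ => ψ₂ (τ, z.2)) (dψ₂ z) z.1)
    (hc₂ : ContinuousOn dψ₂ (Ioi (0:ℝ) ×ˢ S))
    (hs : ContinuousOn (slopeSpWrt S ρ ψ₁) (Ioi (0:ℝ) ×ˢ S))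
    {z : ℝ × Y} (hz : z ∈ Ioi (0:ℝ) ×ˢ S)
    (hl : lowerSlopeSpWrt S ρ ψ₁ z = slopeSpWrt S ρ ψ₁ z)
    {ε : ℝ} (hε : 0 < ε) (hεp : slopeSpWrt S ρ ψ₁ z = 0 ∨ ε ≤ slopeSpWrt S ρ ψ₁ z) :
    ∃ R > 0, ∀ δ₀ > 0, ∃ δ, 0 < δ ∧ δ ≤ δ₀ ∧ ∃ κ, 0 ≤ κ ∧ ∃ y ∈ S,
      (∀ w ∈ Ioi (0:ℝ) ×ˢ S, dist w z ≤ R →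
        ψ₁ w + ψ₂ w - (ψ₁ z + ψ₂ z) ≤ (dψ₁ z + dψ₂ z) * (w.1 - z.1) + ε * |w.1 - z.1|
          + κ * (ρ w.2 y ^ 2 - ρ z.2 y ^ 2) + 2 * ε * δ
          + (uscWrt (Ioi (0:ℝ) ×ˢ S) (slopeSpWrt S ρ ψ₂) z + 2 * ε) * ρ w.2 z.2) ∧
      ∀ x ∈ S, |2 * κ * ρ x y - slopeSpWrt S ρ ψ₁ z|
        ≤ ε + (slopeSpWrt S ρ ψ₁ z + ε) * (ρ x z.2 / δ) := by
  set p := slopeSpWrt S ρ ψ₁ z with hp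
  set a := uscWrt (Ioi (0:ℝ) ×ˢ S) (slopeSpWrt S ρ ψ₂) z with ha
  have hp0 : 0 ≤ p := hm.slopeWrt_nonneg (fun x => ψ₁ (z.1, x)) hz.2
  have hsec : Tendsto (fun x => (z.1, x)) (𝓝[S] z.2) (𝓝[Ioi (0:ℝ) ×ˢ S] z) :=
    tendsto_mk_nhdsWithin hz.1 z.2
  obtain ⟨R₀, hR₀, hR₀b⟩ := exists_time_bound (ψ := fun w => ψ₁ w + ψ₂ w)
    (dψ := fun w => dψ₁ w + dψ₂ w) (fun w hw => (hd₁ w hw).add (hd₂ w hw)) (hc₁.add hc₂) hz hε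
  obtain ⟨r₁, hr₁, hr₁b⟩ := hm.exists_space_bound hg (f := fun x => ψ₁ (z.1, x))
    (hm.locLipWrt_section h₁ hz.1) hz.2 (L := p + ε)
    (hsec.eventually (((hs z hz).eventually_lt_const (lt_add_of_pos_right p hε)).mono
      fun _ h => h.le))
  obtain ⟨r₂, hr₂, hr₂b⟩ := hm.exists_space_bound hg (f := fun x => ψ₂ (z.1, x))
    (hm.locLipWrt_section h₂ hz.1) hz.2 (L := a + ε)
    (hsec.eventually ((hm.eventually_slopeSpWrt_lt h₂ hz (lt_add_of_pos_right a hε)).mono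
      fun _ h => h.le))
  obtain ⟨R₁, hR₁, hR₁b⟩ := Metric.mem_nhdsWithin_iff.1
    (hm.eventually_lt hz.2 (lt_min hr₁ hr₂))
  have hzz : ρ z.2 z.2 = 0 := hm.refl _ hz.2
  have hgen : ∀ w ∈ Ioi (0:ℝ) ×ˢ S, dist w z ≤ min R₀ (R₁ / 2) → ρ z.2 w.2 < r₁ ∧
      ψ₁ w + ψ₂ w ≤ ψ₁ (z.1, w.2) + ψ₂ z + (dψ₁ z + dψ₂ z) * (w.1 - z.1) + ε * |w.1 - z.1|
        + (a + ε) * ρ w.2 z.2 := by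
    intro w hw hwR
    have h1 := hR₀b w hw (hwR.trans (min_le_left _ _))
    have h2 : ρ z.2 w.2 < min r₁ r₂ := hR₁b ⟨by
      have : dist w.2 z.2 ≤ R₁ / 2 := (le_max_right _ _).trans (hwR.trans (min_le_right _ _))
      exact mem_ball.2 (by linarith), hw.2⟩
    have h3 := hr₂b w.2 hw.2 z.2 hz.2 (h2.trans_le (min_le_right _ _)) (by rwa [hzz])
    refine ⟨h2.trans_le (min_le_left _ _), ?_⟩
    simp only [Prod.mk.eta] at h3
    linarith
  refine ⟨min R₀ (R₁ / 2), lt_min hR₀ (by positivity), fun δ₀ hδ₀ => ?_⟩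
  rcases hεp with hp' | hεp
  · refine ⟨δ₀, hδ₀, le_rfl, 0, le_rfl, z.2, hz.2, fun w hw hwR => ?_, fun x hx => ?_⟩
    · obtain ⟨h1, h2⟩ := hgen w hw hwR
      have h3 := hr₁b w.2 hw.2 z.2 hz.2 h1 (by rwa [hzz])
      simp only [Prod.mk.eta] at h3
      rw [hp', zero_add] at h3
      have : 0 < ε * δ₀ := by positivity
      linarith
    · have := hm.nonneg hx hz.2
      rw [hp']
      simp only [mul_zero, zero_mul, sub_zero, abs_zero, zero_add]
      positivity
  · have hpε : 0 < p := hε.trans_le hεp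
    obtain ⟨y, hyf, hyr, hyS⟩ := ((hm.frequently_descent (f := fun x => ψ₁ (z.1, x)) hz.2
      (sub_nonneg.2 hεp) (by
        change p - ε < lowerSlopeSpWrt S ρ ψ₁ z
        rw [hl]; linarith)).and_eventually
      (((hm.eventually_lt hz.2 (lt_min hr₁ hδ₀)).filter_mono
        (nhdsWithin_mono _ sdiff_subset)).and self_mem_nhdsWithin)).exists
    simp only [Prod.mk.eta] at hyf
    set δ := ρ z.2 y with hδ
    have hδ0 : 0 < δ := hm.pos hz.2 hyS.1 (Ne.symm hyS.2)
    refine ⟨δ, hδ0, (hyr.trans_le (min_le_right _ _)).le, (p + ε) / (2 * δ), by positivity, y,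
      hyS.1, fun w hw hwR => ?_, fun x hx => ?_⟩
    · obtain ⟨h1, h2⟩ := hgen w hw hwR
      have h3 := hr₁b w.2 hw.2 y hyS.1 h1 (hyr.trans_le (min_le_left _ _))
      have h4 : (p + ε) / (2 * δ) * (ρ w.2 y ^ 2 - δ ^ 2)
          = (p + ε) * ρ w.2 y - (p + ε) * δ + (p + ε) / (2 * δ) * (ρ w.2 y - δ) ^ 2 := by
        field_simp; ring
      have h5 : 0 ≤ (p + ε) / (2 * δ) * (ρ w.2 y - δ) ^ 2 := by positivity
      have h6 : 0 ≤ ε * ρ w.2 z.2 := mul_nonneg hε.le (hm.nonneg hw.2 hz.2)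
      rw [h4]
      linarith
    · have h1 := hm.abs_sub_le hx hz.2 hyS.1
      have h2 : 2 * ((p + ε) / (2 * δ)) * ρ x y - p
          = ε + (p + ε) * ((ρ x y - δ) / δ) := by
        field_simp; ring
      rw [h2]
      refine (abs_add_le _ _).trans ?_
      rw [abs_of_pos hε, abs_mul, abs_of_pos (by positivity), abs_div, abs_of_pos hδ0]
      gcongr

theorem continuousOn_of_locLipWrt_prodMet (hm : IsMetricOn S ρ) {T : Set ℝ} {ψ : ℝ × Y → ℝ}
    (hψ : LocLipWrt (T ×ˢ S) (prodMet ρ) ψ) : ContinuousOn ψ (T ×ˢ S) := by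
  intro z hz
  obtain ⟨K, U, hU, hK⟩ := hψ z hz
  rw [ContinuousWithinAt, Metric.tendsto_nhds]
  intro ε hε
  have hpos : 0 < ε / (|K| + 1) := by positivity
  have h1 : ∀ᶠ w in 𝓝[T ×ˢ S] z, |w.1 - z.1| < ε / (|K| + 1) :=
    (tendsto_fst_nhdsWithin z).eventually
      (mem_nhdsWithin_of_mem_nhds (ball_mem_nhds z.1 hpos))
  filter_upwards [h1, (tendsto_snd_nhdsWithin z).eventually (hm.eventually_lt hz.2 hpos), hU,
    self_mem_nhdsWithin] with w hw1 hw2 hwU hwS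
  have h2 := hK z ⟨mem_of_mem_nhdsWithin hz hU, hz⟩ w ⟨hwU, hwS⟩
  have h3 : prodMet ρ z w < ε / (|K| + 1) := max_lt (by rwa [abs_sub_comm]) hw2
  have h4 : 0 ≤ prodMet ρ z w := (abs_nonneg _).trans (le_max_left _ _)
  rw [lt_div_iff₀ (by positivity)] at h3
  rw [Real.dist_eq, abs_sub_comm]
  have h5 : K * prodMet ρ z w ≤ |K| * prodMet ρ z w :=
    mul_le_mul_of_nonneg_right (le_abs_self K) h4
  nlinarith

end IsMetricOn

theorem eventually_eventually_approxFilter {Z : Type*} [TopologicalSpace Z] {S : ℕ → Set Z}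
    {z : Z} {P : ℕ × Z → Prop} (h : ∀ᶠ q in approxFilter S z, P q) :
    ∀ᶠ q in approxFilter S z, ∀ᶠ v in 𝓝[S q.1] q.2, P (q.1, v) := by
  rw [approxFilter, eventually_inf_principal, eventually_prod_iff] at h
  obtain ⟨p₁, h₁, p₂, h₂, hp⟩ := h
  filter_upwards [tendsto_fst_approxFilter.eventually h₁,
    tendsto_snd_approxFilter.eventually (eventually_eventually_nhds.2 h₂)] with q hq1 hq2
  filter_upwards [mem_nhdsWithin_of_mem_nhds hq2, self_mem_nhdsWithin] with v hv hvS
  exact hp hq1 hv hvS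

/-- The upper semilimit of a sequence of functions on varying spaces. -/
noncomputable def upperSemilimit {Y : Type*} [TopologicalSpace Y] (X : ℕ → Set Y)
    (u : ℕ → ℝ × Y → ℝ) (z : ℝ × Y) : ℝ :=
  sSup {L : ℝ | ∃ tn : ℕ → ℝ, ∃ xn : ℕ → Y, (∀ n, xn n ∈ X n) ∧
    Tendsto tn atTop (𝓝 z.1) ∧ Tendsto xn atTop (𝓝 z.2) ∧
    Filter.limsup (fun n => u n (tn n, xn n)) atTop = L}

theorem eventually_abs_le_of_tendsto {Y : Type*} {X : ℕ → Set Y} {u : ℕ → ℝ × Y → ℝ} {C : ℝ}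
    (hC : ∀ n, ∀ t ∈ Ioi (0:ℝ), ∀ x ∈ X n, |u n (t, x)| ≤ C)
    {z : ℝ × Y} (hz : 0 < z.1) {tn : ℕ → ℝ} {xn : ℕ → Y} (hx : ∀ n, xn n ∈ X n)
    (ht : Tendsto tn atTop (𝓝 z.1)) : ∀ᶠ n in atTop, |u n (tn n, xn n)| ≤ C :=
  (ht.eventually_const_lt hz).mono fun n hn => hC n _ hn _ (hx n)

section UpperSemilimit

variable {Y : Type*} [MetricSpace Y] {X : ℕ → Set Y} {Xi : Set Y} {u : ℕ → ℝ × Y → ℝ} {C : ℝ}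

theorem limsup_le_upperSemilimit
    (hC : ∀ n, ∀ t ∈ Ioi (0:ℝ), ∀ x ∈ X n, |u n (t, x)| ≤ C)
    {z : ℝ × Y} (hz : 0 < z.1) {tn : ℕ → ℝ} {xn : ℕ → Y} (hx : ∀ n, xn n ∈ X n)
    (ht : Tendsto tn atTop (𝓝 z.1)) (hxz : Tendsto xn atTop (𝓝 z.2)) :
    limsup (fun n => u n (tn n, xn n)) atTop ≤ upperSemilimit X u z := by
  refine le_csSup ⟨C, ?_⟩ ⟨tn, xn, hx, ht, hxz, rfl⟩
  rintro _ ⟨t, x, hx, ht, -, rfl⟩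
  have h := eventually_abs_le_of_tendsto hC hz hx ht
  exact limsup_le_of_le (IsBoundedUnder.isCoboundedUnder_le
    ⟨-C, eventually_map.2 (h.mono fun n hn => (abs_le.1 hn).1)⟩) (h.mono fun n hn => (abs_le.1 hn).2)

theorem abs_upperSemilimit_le (hC : ∀ n, ∀ t ∈ Ioi (0:ℝ), ∀ x ∈ X n, |u n (t, x)| ≤ C)
    {z : ℝ × Y} (hz : 0 < z.1) {c : ℕ → Y} (hc : ∀ n, c n ∈ X n)
    (hcz : Tendsto c atTop (𝓝 z.2)) : |upperSemilimit X u z| ≤ C := by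
  rw [abs_le]
  constructor
  · refine le_trans ?_ (limsup_le_upperSemilimit hC hz hc (tendsto_const_nhds (x := z.1)) hcz)
    have h := eventually_abs_le_of_tendsto hC hz hc (tendsto_const_nhds (x := z.1))
    exact le_limsup_of_frequently_le (h.mono fun n hn => (abs_le.1 hn).1).frequently
      ⟨C, eventually_map.2 (h.mono fun n hn => (abs_le.1 hn).2)⟩
  · refine csSup_le ⟨_, _, c, hc, tendsto_const_nhds, hcz, rfl⟩ ?_
    rintro _ ⟨t, x, hx, ht, -, rfl⟩
    have h := eventually_abs_le_of_tendsto hC hz hx ht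
    exact limsup_le_of_le (IsBoundedUnder.isCoboundedUnder_le
      ⟨-C, eventually_map.2 (h.mono fun n hn => (abs_le.1 hn).1)⟩)
      (h.mono fun n hn => (abs_le.1 hn).2)

theorem eventually_lt_of_upperSemilimit_lt
    (hC : ∀ n, ∀ t ∈ Ioi (0:ℝ), ∀ x ∈ X n, |u n (t, x)| ≤ C)
    {z : ℝ × Y} (hz : 0 < z.1) {c : ℕ → Y} (hc : ∀ n, c n ∈ X n)
    (hcz : Tendsto c atTop (𝓝 z.2)) {l : ℝ} (hl : upperSemilimit X u z < l) :
    ∀ᶠ q in approxFilter (fun n => Ioi (0:ℝ) ×ˢ X n) z, u q.1 q.2 < l := by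
  by_contra hcon
  obtain ⟨w, hw, hwz, hP⟩ := exists_seq_of_frequently_approxFilter
    (S := fun n => Ioi (0:ℝ) ×ˢ X n) (c := fun n => (z.1, c n))
    (P := fun q : ℕ × ℝ × Y => ¬ u q.1 q.2 < l) (fun n => ⟨hz, hc n⟩)
    (tendsto_const_nhds.prodMk_nhds hcz) (not_eventually.1 hcon)
  have hw1 : Tendsto (fun n => (w n).1) atTop (𝓝 z.1) := (continuous_fst.tendsto z).comp hwz
  have hw2 : Tendsto (fun n => (w n).2) atTop (𝓝 z.2) := (continuous_snd.tendsto z).comp hwz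
  have h := limsup_le_upperSemilimit hC hz (fun n => (hw n).2) hw1 hw2
  refine (hl.trans_le ?_).not_ge h
  exact le_limsup_of_frequently_le (hP.mono fun n hn => not_lt.1 hn)
    ⟨C, eventually_map.2 (Eventually.of_forall fun n =>
      (abs_le.1 (hC n _ (hw n).1 _ (hw n).2)).2)⟩

theorem eventually_uscWrt_le (hC : ∀ n, ∀ t ∈ Ioi (0:ℝ), ∀ x ∈ X n, |u n (t, x)| ≤ C)
    {z : ℝ × Y} (hz : 0 < z.1) {c : ℕ → Y} (hc : ∀ n, c n ∈ X n)
    (hcz : Tendsto c atTop (𝓝 z.2)) {l : ℝ} (hl : upperSemilimit X u z < l) :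
    ∀ᶠ q in approxFilter (fun n => Ioi (0:ℝ) ×ˢ X n) z,
      uscWrt (Ioi (0:ℝ) ×ˢ X q.1) (u q.1) q.2 ≤ l := by
  filter_upwards [eventually_eventually_approxFilter
    (eventually_lt_of_upperSemilimit_lt hC hz hc hcz hl), eventually_mem_approxFilter]
    with q hq hqS
  exact uscWrt_le (C := -C) (fun w hw => (abs_le.1 (hC q.1 _ hw.1 _ hw.2)).1) hqS
    (hq.mono fun _ h => h.le)

theorem frequently_lt_of_lt_uscWrt_upperSemilimit
    (hC : ∀ n, ∀ t ∈ Ioi (0:ℝ), ∀ x ∈ X n, |u n (t, x)| ≤ C)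
    (hrec : ∀ x ∈ Xi, ∃ c : ℕ → Y, (∀ n, c n ∈ X n) ∧ Tendsto c atTop (𝓝 x))
    {z : ℝ × Y} (hz : z ∈ Ioi (0:ℝ) ×ˢ Xi) {l : ℝ}
    (hl : l < uscWrt (Ioi (0:ℝ) ×ˢ Xi) (upperSemilimit X u) z) :
    ∃ᶠ q in approxFilter (fun n => Ioi (0:ℝ) ×ˢ X n) z, l < u q.1 q.2 := by
  intro hcon
  rw [approxFilter, eventually_inf_principal, eventually_prod_iff] at hcon
  obtain ⟨p₁, h₁, p₂, h₂, hp⟩ := hcon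
  refine hl.not_ge (uscWrt_le (C := -C) ?_ hz ?_)
  · intro w hw
    obtain ⟨c, hc, hcw⟩ := hrec _ hw.2
    exact (abs_le.1 (abs_upperSemilimit_le hC hw.1 hc hcw)).1
  · filter_upwards [mem_nhdsWithin_of_mem_nhds (eventually_eventually_nhds.2 h₂),
      self_mem_nhdsWithin] with w hw hwS
    obtain ⟨c, hc, hcw⟩ := hrec _ hwS.2
    refine csSup_le ⟨_, _, c, hc, tendsto_const_nhds, hcw, rfl⟩ ?_
    rintro _ ⟨t, x, hx, ht, hxw, rfl⟩
    have h := eventually_abs_le_of_tendsto hC hwS.1 hx ht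
    refine limsup_le_of_le (IsBoundedUnder.isCoboundedUnder_le
      ⟨-C, eventually_map.2 (h.mono fun n hn => (abs_le.1 hn).1)⟩) ?_
    filter_upwards [h₁, (ht.prodMk_nhds hxw).eventually hw, ht.eventually_const_lt hwS.1]
      with n hn1 hn2 hn3
    exact not_lt.1 (hp hn1 hn2 ⟨hn3, hx n⟩)

end UpperSemilimit

theorem exists_frequently_maximizers {Y : Type*} [MetricSpace Y] {X : ℕ → Set Y} {Xi : Set Y}
    (hXine : Xi.Nonempty) (hXc : ∀ n, IsCompact (X n)) (hXic : IsCompact Xi)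
    (h1 : Tendsto (fun n => hausdorffDist (X n) Xi) atTop (𝓝 0)) {g : ℕ → ℝ × Y → ℝ}
    (hg : ∀ n, UpperSemicontinuousOn (g n) (Ioi (0:ℝ) ×ˢ X n)) {z : ℝ × Y} {R m : ℝ}
    (hR₀ : 0 < R) (hR : R < z.1)
    (h : ∃ᶠ q in approxFilter (fun n => Ioi (0:ℝ) ×ˢ X n) z, m < g q.1 q.2) :
    ∃ w₀ ∈ Ioi (0:ℝ) ×ˢ Xi, dist w₀ z ≤ R ∧
      ∃ᶠ q in approxFilter (fun n => Ioi (0:ℝ) ×ˢ X n) w₀,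
        m < g q.1 q.2 ∧ ∀ v ∈ Ioi (0:ℝ) ×ˢ X q.1, dist v z ≤ R → g q.1 v ≤ g q.1 q.2 := by
  refine exists_frequently_approxFilter hXine hXc hXic h1 hR
    (Q := fun n w => m < g n w ∧ ∀ v ∈ Ioi (0:ℝ) ×ˢ X n, dist v z ≤ R → g n v ≤ g n w) ?_
  have h' : ∃ᶠ q in approxFilter (fun n => Ioi (0:ℝ) ×ˢ X n) z,
      ∃ w ∈ Ioi (0:ℝ) ×ˢ X q.1, dist w z ≤ R ∧ m < g q.1 w := by
    refine (h.and_eventually (eventually_mem_approxFilter.and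
      (tendsto_snd_approxFilter.eventually (ball_mem_nhds z hR₀)))).mono ?_
    rintro q ⟨hq, hqS, hqz⟩
    exact ⟨q.2, hqS, (mem_ball.1 hqz).le, hq⟩
  refine (tendsto_fst_approxFilter.frequently
    (p := fun n => ∃ w ∈ Ioi (0:ℝ) ×ˢ X n, dist w z ≤ R ∧ m < g n w) h').mono ?_
  rintro n ⟨w, hwS, hwz, hw⟩
  have hsub : closedBall z.1 R ×ˢ (X n ∩ closedBall z.2 R) ⊆ Ioi (0:ℝ) ×ˢ X n := by
    rintro v ⟨hv1, hv2, -⟩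
    refine ⟨?_, hv2⟩
    rw [mem_closedBall, Real.dist_eq, abs_le] at hv1
    rw [mem_Ioi]; linarith
  have hmem : ∀ v ∈ Ioi (0:ℝ) ×ˢ X n, dist v z ≤ R →
      v ∈ closedBall z.1 R ×ˢ (X n ∩ closedBall z.2 R) := fun v hv hvz =>
    ⟨(le_max_left _ _).trans hvz, hv.2, (le_max_right _ _).trans hvz⟩
  have hcomp : IsCompact (closedBall z.1 R ×ˢ (X n ∩ closedBall z.2 R)) :=
    (isCompact_closedBall _ _).prod ((hXc n).inter_right isClosed_closedBall)
  obtain ⟨v, hv, hvmax⟩ := ((hg n).mono hsub).exists_isMaxOn ⟨w, hmem w hwS hwz⟩ hcomp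
  exact ⟨v, hsub hv, max_le hv.1 hv.2.2, hw.trans_le (hvmax (hmem w hwS hwz)),
    fun v' hv' hvz' => hvmax (hmem v' hv' hvz')⟩

theorem tendsto_penalty {Y : Type*} [MetricSpace Y] {X : ℕ → Set Y} {Xi : Set Y}
    {d : ℕ → Y → Y → ℝ} {di : Y → Y → ℝ}
    (h2 : ∀ a ∈ Xi, ∀ b ∈ Xi, ∀ an bn : ℕ → Y, (∀ n, an n ∈ X n) → (∀ n, bn n ∈ X n) →
      Tendsto an atTop (𝓝 a) → Tendsto bn atTop (𝓝 b) →
      Tendsto (fun n => d n (an n) (bn n)) atTop (𝓝 (di a b)))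
    (hrec : ∀ x ∈ Xi, ∃ c : ℕ → Y, (∀ n, c n ∈ X n) ∧ Tendsto c atTop (𝓝 x))
    {y : Y} (hy : y ∈ Xi) {c : ℕ → Y} (hc : ∀ n, c n ∈ X n) (hcy : Tendsto c atTop (𝓝 y))
    {z : ℝ × Y} (hz : z ∈ Ioi (0:ℝ) ×ˢ Xi) :
    Tendsto (fun q : ℕ × ℝ × Y => d q.1 q.2.2 (c q.1))
      (approxFilter (fun n => Ioi (0:ℝ) ×ˢ X n) z) (𝓝 (di z.2 y)) := by
  obtain ⟨e, he, hez⟩ := hrec z.2 hz.2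
  refine tendsto_approxFilter (S := fun n => Ioi (0:ℝ) ×ˢ X n) (c := fun n => (z.1, e n)) (f := fun n w => d n w.2 (c n))
    (fun n => ⟨hz.1, he n⟩) (tendsto_const_nhds.prodMk_nhds hez) fun w hw hwz => ?_
  exact h2 z.2 hz.2 y hy _ c (fun n => (hw n).2) hc ((continuous_snd.tendsto z).comp hwz) hcy

theorem lt_of_quadratic_lt {ε δ s E : ℝ} (hε : 0 < ε) (hδ : 0 < δ) (hE : 0 ≤ E)
    (h : ε / δ * s ^ 2 + E < ε * |s| + 3 * ε * δ) : |s| < 4 * δ ∧ E < 4 * (ε * δ) := by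
  have hs : s ^ 2 = |s| ^ 2 := (sq_abs s).symm
  have hk : ∀ k : ℝ, ε * (2 * k * |s| - k ^ 2 * δ) ≤ ε / δ * s ^ 2 := by
    intro k
    have : ε / δ * s ^ 2 - ε * (2 * k * |s| - k ^ 2 * δ) = ε / δ * (|s| - k * δ) ^ 2 := by
      rw [hs]; field_simp; ring
    have h0 : 0 ≤ ε / δ * (|s| - k * δ) ^ 2 := by positivity
    linarith
  have hεδ : 0 < ε * δ := by positivity
  constructor
  · have h1 := hk 1
    refine lt_of_mul_lt_mul_left ?_ hε.le
    nlinarith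
  · have h1 := hk (1 / 2)
    nlinarith

theorem exists_pos_small {p η : ℝ} (hp : 0 ≤ p) (hη : 0 < η) :
    ∃ c : ℝ, 0 < c ∧ c ≤ 1 ∧ c * (20 + 4 * p) ≤ η ∧ (p = 0 ∨ c ≤ p) := by
  have h20 : 0 < 20 + 4 * p := by linarith
  have hq : η / (20 + 4 * p) * (20 + 4 * p) = η := div_mul_cancel₀ _ h20.ne'
  rcases hp.eq_or_lt with h | h
  · refine ⟨min 1 (η / (20 + 4 * p)), lt_min one_pos (div_pos hη h20), min_le_left _ _, ?_,
      Or.inl h.symm⟩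
    exact (mul_le_mul_of_nonneg_right (min_le_right _ _) h20.le).trans hq.le
  · refine ⟨min (min 1 p) (η / (20 + 4 * p)), lt_min (lt_min one_pos h) (div_pos hη h20),
      (min_le_left _ _).trans (min_le_left _ _), ?_,
      Or.inr ((min_le_left _ _).trans (min_le_right _ _))⟩
    exact (mul_le_mul_of_nonneg_right (min_le_right _ _) h20.le).trans hq.le

set_option maxHeartbeats 800000 in
/-- Near a local maximum point of the envelope of the upper semilimit minus a test function,
the approximating equations hold approximately. -/
theorem exists_approx_subsolution {Y : Type*} [MetricSpace Y]
    {X : ℕ → Set Y} {Xi : Set Y} {d : ℕ → Y → Y → ℝ} {di : Y → Y → ℝ}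
    {H : ℕ → ℝ → Y → ℝ → ℝ → ℝ} {u : ℕ → ℝ × Y → ℝ}
    (hXne : ∀ n, (X n).Nonempty) (hXc : ∀ n, IsCompact (X n))
    (hXine : Xi.Nonempty) (hXic : IsCompact Xi)
    (hmet : ∀ n, IsMetricOn (X n) (d n)) (hgeo : ∀ n, IsGeodesicWrt (X n) (d n))
    (hmeti : IsMetricOn Xi di) (hgeoi : IsGeodesicWrt Xi di)
    (h1 : Tendsto (fun n => hausdorffDist (X n) Xi) atTop (𝓝 0))
    (h2 : ∀ a ∈ Xi, ∀ b ∈ Xi, ∀ an bn : ℕ → Y, (∀ n, an n ∈ X n) → (∀ n, bn n ∈ X n) →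
      Tendsto an atTop (𝓝 a) → Tendsto bn atTop (𝓝 b) →
      Tendsto (fun n => d n (an n) (bn n)) atTop (𝓝 (di a b)))
    (hsub : ∀ n, IsMVSubsolutionTWrt (X n) (d n) (H n) (u n))
    {C : ℝ} (hC : ∀ n, ∀ t ∈ Ioi (0:ℝ), ∀ x ∈ X n, |u n (t, x)| ≤ C)
    {ψ₁ ψ₂ dψ₁ dψ₂ : ℝ × Y → ℝ}
    (h₁ : LocLipWrt (Ioi (0:ℝ) ×ˢ Xi) (prodMet di) ψ₁)
    (h₂ : LocLipWrt (Ioi (0:ℝ) ×ˢ Xi) (prodMet di) ψ₂)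
    (hd₁ : ∀ z ∈ Ioi (0:ℝ) ×ˢ Xi, HasDerivAt (fun τ => ψ₁ (τ, z.2)) (dψ₁ z) z.1)
    (hc₁ : ContinuousOn dψ₁ (Ioi (0:ℝ) ×ˢ Xi))
    (hd₂ : ∀ z ∈ Ioi (0:ℝ) ×ˢ Xi, HasDerivAt (fun τ => ψ₂ (τ, z.2)) (dψ₂ z) z.1)
    (hc₂ : ContinuousOn dψ₂ (Ioi (0:ℝ) ×ˢ Xi))
    (hs : ContinuousOn (slopeSpWrt Xi di ψ₁) (Ioi (0:ℝ) ×ˢ Xi))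
    {z : ℝ × Y} (hz : z ∈ Ioi (0:ℝ) ×ˢ Xi)
    (hl : lowerSlopeSpWrt Xi di ψ₁ z = slopeSpWrt Xi di ψ₁ z)
    (hmax : IsLocalMaxOn (fun w => uscWrt (Ioi (0:ℝ) ×ˢ Xi) (upperSemilimit X u) w -
      (ψ₁ w + ψ₂ w)) (Ioi (0:ℝ) ×ˢ Xi) z)
    {η : ℝ} (hη : 0 < η) (N : ℕ) :
    ∃ n ≥ N, ∃ w ∈ Ioi (0:ℝ) ×ˢ X n, ∃ r q, dist w z ≤ η ∧
      |r - uscWrt (Ioi (0:ℝ) ×ˢ Xi) (upperSemilimit X u) z| ≤ η ∧ 0 ≤ q ∧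
      |q - slopeSpWrt Xi di ψ₁ z| ≤
        uscWrt (Ioi (0:ℝ) ×ˢ Xi) (slopeSpWrt Xi di ψ₂) z + η ∧
      dψ₁ z + dψ₂ z + H n w.1 w.2 r q ≤ η := by
  have hrec : ∀ x ∈ Xi, ∃ c : ℕ → Y, (∀ n, c n ∈ X n) ∧ Tendsto c atTop (𝓝 x) :=
    fun x hx => exists_mem_approximants hXne hXc hXic h1 hx
  have hp0 : 0 ≤ slopeSpWrt Xi di ψ₁ z := hmeti.slopeWrt_nonneg (fun x => ψ₁ (z.1, x)) hz.2
  have ha0 : 0 ≤ uscWrt (Ioi (0:ℝ) ×ˢ Xi) (slopeSpWrt Xi di ψ₂) z := by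
    refine limsup_nonneg_of_eventually_nonneg ?_
    filter_upwards [self_mem_nhdsWithin] with w hw
    exact hmeti.slopeWrt_nonneg (fun x => ψ₂ (w.1, x)) hw.2
  obtain ⟨c, hc0, hc1, hcη, hcp⟩ := exists_pos_small hp0 hη
  have hcc : c ^ 2 ≤ c := by nlinarith
  obtain ⟨R₁, hR₁, hmodel⟩ := hmeti.exists_model_bound hgeoi h₁ h₂ hd₁ hc₁ hd₂ hc₂ hs hz hl
    (ε := c ^ 2) (by positivity) (hcp.imp_right hcc.trans)
  set p := slopeSpWrt Xi di ψ₁ z with hp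
  set a := uscWrt (Ioi (0:ℝ) ×ˢ Xi) (slopeSpWrt Xi di ψ₂) z with ha
  set V := uscWrt (Ioi (0:ℝ) ×ˢ Xi) (upperSemilimit X u) with hV
  set A := dψ₁ z + dψ₂ z with hA
  set ε := c ^ 2 with hε
  have hε0 : 0 < ε := by positivity
  obtain ⟨R₂, hR₂, hψR⟩ : ∃ R₂ > 0, ∀ w ∈ Ioi (0:ℝ) ×ˢ Xi, dist w z < R₂ →
      |ψ₁ w + ψ₂ w - (ψ₁ z + ψ₂ z)| < η / 2 := by
    have hcont := ((hmeti.continuousOn_of_locLipWrt_prodMet h₁).add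
      (hmeti.continuousOn_of_locLipWrt_prodMet h₂)) z hz
    obtain ⟨R₂, hR₂, h⟩ := Metric.continuousWithinAt_iff.1 hcont (η / 2) (half_pos hη)
    exact ⟨R₂, hR₂, fun w hw hwz => by simpa [Real.dist_eq] using h hw hwz⟩
  obtain ⟨R₃, hR₃, hmaxR⟩ : ∃ R₃ > 0, ∀ w ∈ Ioi (0:ℝ) ×ˢ Xi, dist w z < R₃ →
      V w - (ψ₁ w + ψ₂ w) ≤ V z - (ψ₁ z + ψ₂ z) := by
    obtain ⟨R₃, hR₃, h⟩ := Metric.mem_nhdsWithin_iff.1 hmax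
    exact ⟨R₃, hR₃, fun w hw hwz => h ⟨hwz, hw⟩⟩
  obtain ⟨R, hR0, hRR₁, hRR₂, hRR₃, hRz, hRη⟩ : ∃ R > 0, R ≤ R₁ ∧ R < R₂ ∧ R < R₃ ∧
      R < z.1 ∧ R ≤ η := by
    have hz1 : 0 < z.1 := hz.1
    refine ⟨min R₁ (min (R₂ / 2) (min (R₃ / 2) (min (z.1 / 2) η))), by positivity,
      min_le_left _ _, ?_, ?_, ?_, ?_⟩
    · exact ((min_le_right _ _).trans (min_le_left _ _)).trans_lt (half_lt_self hR₂)
    · exact ((min_le_right _ _).trans ((min_le_right _ _).trans (min_le_left _ _))).trans_lt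
        (half_lt_self hR₃)
    · exact ((min_le_right _ _).trans ((min_le_right _ _).trans
        ((min_le_right _ _).trans (min_le_left _ _)))).trans_lt (half_lt_self hz1)
    · exact (min_le_right _ _).trans ((min_le_right _ _).trans
        ((min_le_right _ _).trans (min_le_right _ _)))
  obtain ⟨δ, hδ0, hδδ, κ, hκ, y, hy, hbound, hslope⟩ := hmodel (min (R / 9) (η / 8))
    (lt_min (by positivity) (by positivity))
  have hδR : δ ≤ R / 9 := hδδ.trans (min_le_left _ _)
  have hδη : δ ≤ η / 8 := hδδ.trans (min_le_right _ _)
  have hεδ : 0 < ε * δ := mul_pos hε0 hδ0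
  have hε1 : ε ≤ 1 := hcc.trans hc1
  have hεδ1 : ε * δ ≤ δ := by nlinarith
  obtain ⟨cx, hcxX, hcx⟩ := hrec z.2 hz.2
  obtain ⟨cy, hcyX, hcy⟩ := hrec y hy
  set b := a + 2 * ε + c with hb
  have hb0 : 0 ≤ b := by positivity
  set Φ : ℝ × Y → ℝ := fun w => A * (w.1 - z.1) + ε / δ * (w.1 - z.1) ^ 2
    + κ * di w.2 y ^ 2 + b * di w.2 z.2 with hΦ
  set Φn : ℕ → ℝ × Y → ℝ := fun n w => A * (w.1 - z.1) + ε / δ * (w.1 - z.1) ^ 2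
    + κ * d n w.2 (cy n) ^ 2 + b * d n w.2 (cx n) with hΦn
  have hΦlim : ∀ w ∈ Ioi (0:ℝ) ×ˢ Xi, Tendsto (fun q : ℕ × ℝ × Y => Φn q.1 q.2)
      (approxFilter (fun n => Ioi (0:ℝ) ×ˢ X n) w) (𝓝 (Φ w)) := by
    intro w hw
    have ht : Tendsto (fun q : ℕ × ℝ × Y => q.2.1 - z.1)
        (approxFilter (fun n => Ioi (0:ℝ) ×ˢ X n) w) (𝓝 (w.1 - z.1)) :=
      ((continuous_fst.tendsto w).comp tendsto_snd_approxFilter).sub_const _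
    exact (((ht.const_mul A).add ((ht.pow 2).const_mul _)).add
      (((tendsto_penalty h2 hrec hy hcyX hcy hw).pow 2).const_mul κ)).add
      ((tendsto_penalty h2 hrec hz.2 hcxX hcx hw).const_mul b)
  have hC' : ∀ n, ∀ w ∈ Ioi (0:ℝ) ×ˢ X n, |u n w| ≤ C := fun n w hw => hC n _ hw.1 _ hw.2
  have husc : ∀ n, UpperSemicontinuousOn
      (fun w => uscWrt (Ioi (0:ℝ) ×ˢ X n) (u n) w - Φn n w) (Ioi (0:ℝ) ×ˢ X n) := by
    intro n
    have hsnd : MapsTo Prod.snd (Ioi (0:ℝ) ×ˢ X n) (X n) := fun w hw => hw.2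
    have h3 := ((hmet n).continuousOn (hcyX n)).comp continuousOn_snd hsnd
    have h4 := ((hmet n).continuousOn (hcxX n)).comp continuousOn_snd hsnd
    have hcont : ContinuousOn (fun w => -Φn n w) (Ioi (0:ℝ) ×ˢ X n) := by
      refine ContinuousOn.neg (((ContinuousOn.add ?_ ?_).add
        ((h3.pow 2).const_mul κ)).add (h4.const_mul b))
      · fun_prop
      · fun_prop
    simpa only [sub_eq_add_neg] using
      (upperSemicontinuousOn_uscWrt (hC' n)).add hcont.upperSemicontinuousOn
  have hΦz : Φ z = κ * di z.2 y ^ 2 := by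
    simp [hΦ, hmeti.refl _ hz.2]
  have hfreq : ∃ᶠ q in approxFilter (fun n => Ioi (0:ℝ) ×ˢ X n) z,
      V z - Φ z - ε * δ / 3 < uscWrt (Ioi (0:ℝ) ×ˢ X q.1) (u q.1) q.2 - Φn q.1 q.2 := by
    refine ((frequently_lt_of_lt_uscWrt_upperSemilimit hC hrec hz
      (l := V z - ε * δ / 6) (by linarith)).and_eventually (eventually_mem_approxFilter.and
      ((hΦlim z hz).eventually_lt_const (u := Φ z + ε * δ / 6) (by linarith)))).mono ?_
    rintro q ⟨hq, hqS, hqΦ⟩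
    have := le_uscWrt (fun w hw => (abs_le.1 (hC' q.1 w hw)).2) hqS
    linarith
  obtain ⟨v, hv, hvz, hvfreq⟩ := exists_frequently_maximizers hXine hXc hXic h1 husc hR0 hRz hfreq
  set D := di v.2 z.2 with hD
  have hD0 : 0 ≤ D := hmeti.nonneg hv.2 hz.2
  have hVv : upperSemilimit X u v ≤ V v := by
    refine le_uscWrt (C := C) (fun w hw => ?_) hv
    obtain ⟨e, he, hew⟩ := hrec _ hw.2
    exact (abs_le.1 (abs_upperSemilimit_le hC hw.1 he hew)).2
  obtain ⟨e, he, hev⟩ := hrec _ hv.2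
  have hnear : ∀ᶠ q in approxFilter (fun n => Ioi (0:ℝ) ×ˢ X n) v,
      uscWrt (Ioi (0:ℝ) ×ˢ X q.1) (u q.1) q.2 ≤ V v + ε * δ / 3 ∧ Φ v - ε * δ / 3 < Φn q.1 q.2 :=
    (eventually_uscWrt_le hC hv.1 he hev (by linarith)).and
      ((hΦlim v hv).eventually_const_lt (by linarith))
  have hlow : V z - Φ z - ε * δ < V v - Φ v := by
    obtain ⟨q, ⟨hq, -⟩, hq1, hq2⟩ := (hvfreq.and_eventually hnear).exists
    linarith
  have hmv := hmaxR v hv (hvz.trans_lt hRR₃)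
  have hbv := hbound v hv (hvz.trans hRR₁)
  have hΦv : Φ v = A * (v.1 - z.1) + ε / δ * (v.1 - z.1) ^ 2 + κ * di v.2 y ^ 2
    + (a + 2 * ε) * D + c * D := by simp only [hΦ, hb, hD]; ring
  obtain ⟨hs4, hD4⟩ := lt_of_quadratic_lt (s := v.1 - z.1) (E := c * D) hε0 hδ0 (by positivity)
    (by linarith)
  have hD4' : D ≤ 4 * c * δ := by
    refine le_of_mul_le_mul_left ?_ hc0
    have : 4 * (ε * δ) = c * (4 * c * δ) := by rw [hε]; ring
    linarith
  have hvz4 : dist v z ≤ 4 * δ := by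
    refine max_le hs4.le ((hmeti.ge_dist _ hv.2 _ hz.2).trans ?_)
    nlinarith
  have hslv := hslope v.2 hv.2
  obtain ⟨⟨n, w⟩, ⟨hwM, hwmax⟩, ⟨hwV, hwΦ⟩, hwN, hwS, hwv, hwκ⟩ :=
    (hvfreq.and_eventually (hnear.and ((tendsto_fst_approxFilter.eventually_ge_atTop N).and
      (eventually_mem_approxFilter.and
      ((tendsto_snd_approxFilter.eventually (ball_mem_nhds v hδ0)).and
      (((tendsto_penalty h2 hrec hy hcyX hcy hv).const_mul (2 * κ)).eventually
        (ball_mem_nhds _ hε0))))))).exists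
  simp only at hwM hwmax hwV hwΦ hwN hwS hwv hwκ
  rw [Real.dist_eq] at hwκ
  have hwz : dist w z < 5 * δ := by
    have := dist_triangle w v z
    linarith
  have hw1 : |w.1 - z.1| < 5 * δ := (le_max_left _ _).trans_lt hwz
  have hloc : IsLocalMaxOn (fun w => uscWrt (Ioi (0:ℝ) ×ˢ X n) (u n) w - Φn n w)
      (Ioi (0:ℝ) ×ˢ X n) w := by
    have hnb : ∀ᶠ w' in 𝓝 w, dist w' z < R :=
      isOpen_ball.mem_nhds (mem_ball.2 (by linarith))
    filter_upwards [mem_nhdsWithin_of_mem_nhds hnb, self_mem_nhdsWithin] with w' hw' hw'S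
    exact hwmax w' hw'S hw'.le
  obtain ⟨q, hq0, hqb, hqH⟩ := (hmet n).exists_of_isMVSubsolutionTWrt (hgeo n) (hsub n)
    (hcxX n) (hcyX n) hκ hb0 hwS hloc hε0
  have hcp4 : c * p ≥ 0 := by positivity
  refine ⟨n, hwN, w, hwS, uscWrt (Ioi (0:ℝ) ×ˢ X n) (u n) w, q, by linarith, ?_, hq0, ?_, ?_⟩
  · have hψv := abs_lt.1 (hψR v hv (hvz.trans_lt hRR₂))
    have hquad : ε * |v.1 - z.1| - ε * δ ≤ ε / δ * (v.1 - z.1) ^ 2 := by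
      have h0 : 0 ≤ ε / δ * (|v.1 - z.1| - δ / 2) ^ 2 := by positivity
      have h3 : ε / δ * (|v.1 - z.1| - δ / 2) ^ 2 =
          ε / δ * (v.1 - z.1) ^ 2 - ε * |v.1 - z.1| + ε * δ / 4 := by
        rw [← sq_abs (v.1 - z.1)]; field_simp; ring
      linarith
    have hcD : 0 ≤ c * D := by positivity
    rw [abs_le]
    constructor <;> linarith
  · have hDδ : D / δ ≤ 4 * c := by rwa [div_le_iff₀ hδ0]
    have h3 : (p + ε) * (D / δ) ≤ (p + ε) * (4 * c) :=
      mul_le_mul_of_nonneg_left hDδ (by positivity)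
    have h4 : ε * c ≤ c := by nlinarith
    have h5 : |q - p| ≤ b + ε + (ε + (p + ε) * (D / δ)) := by
      refine (abs_sub_le q (2 * κ * d n w.2 (cy n)) p).trans ?_
      have := abs_sub_le (2 * κ * d n w.2 (cy n)) (2 * κ * di v.2 y) p
      linarith
    linarith
  · have h3 : -(ε / δ * (5 * δ)) ≤ ε / δ * (w.1 - z.1) := by
      rw [← mul_neg]
      exact mul_le_mul_of_nonneg_left (by linarith [(abs_lt.1 hw1).1]) (by positivity)
    have h4 : ε / δ * (5 * δ) = 5 * ε := by field_simp
    linarith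

/-- stability of metric viscosity subsolutions for the time-dependent
problem. -/
theorem stmt13 {Y : Type*} [MetricSpace Y] [LocallyCompactSpace Y]
    (X : ℕ → Set Y) (Xi : Set Y)
    (d : ℕ → Y → Y → ℝ) (di : Y → Y → ℝ)
    (H : ℕ → ℝ → Y → ℝ → ℝ → ℝ) (Hi : ℝ → Y → ℝ → ℝ → ℝ)
    (u : ℕ → ℝ × Y → ℝ)
    (hXne : ∀ n, (X n).Nonempty) (hXc : ∀ n, IsCompact (X n))
    (hXine : Xi.Nonempty) (hXic : IsCompact Xi)
    (hmet : ∀ n, IsMetricOn (X n) (d n)) (hgeo : ∀ n, IsGeodesicWrt (X n) (d n))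
    (hmeti : IsMetricOn Xi di) (hgeoi : IsGeodesicWrt Xi di)
    (hHc : ∀ n, ContinuousOn (fun q : (ℝ × Y) × ℝ × ℝ => H n q.1.1 q.1.2 q.2.1 q.2.2)
      ((Ioi (0:ℝ) ×ˢ X n) ×ˢ (univ : Set ℝ) ×ˢ Ici (0:ℝ)))
    (hHic : ContinuousOn (fun q : (ℝ × Y) × ℝ × ℝ => Hi q.1.1 q.1.2 q.2.1 q.2.2)
      ((Ioi (0:ℝ) ×ˢ Xi) ×ˢ (univ : Set ℝ) ×ˢ Ici (0:ℝ)))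
    (h1 : Tendsto (fun n => hausdorffDist (X n) Xi) atTop (𝓝 0))
    (h2 : ∀ a ∈ Xi, ∀ b ∈ Xi, ∀ an bn : ℕ → Y, (∀ n, an n ∈ X n) → (∀ n, bn n ∈ X n) →
      Tendsto an atTop (𝓝 a) → Tendsto bn atTop (𝓝 b) →
      Tendsto (fun n => d n (an n) (bn n)) atTop (𝓝 (di a b)))
    (h3' : ∀ t ∈ Ioi (0:ℝ), ∀ x ∈ Xi, ∀ tn : ℕ → ℝ, (∀ n, tn n ∈ Ioi (0:ℝ)) →
      Tendsto tn atTop (𝓝 t) →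
      ∀ xn : ℕ → Y, (∀ n, xn n ∈ X n) → Tendsto xn atTop (𝓝 x) →
      ∀ r p : ℝ, 0 ≤ p → ∀ rn pn : ℕ → ℝ, (∀ n, 0 ≤ pn n) →
      Tendsto rn atTop (𝓝 r) → Tendsto pn atTop (𝓝 p) →
      Tendsto (fun n => H n (tn n) (xn n) (rn n) (pn n)) atTop (𝓝 (Hi t x r p)))
    (hsub : ∀ n, IsMVSubsolutionTWrt (X n) (d n) (H n) (u n))
    (hbdd : ∃ C : ℝ, ∀ n, ∀ t ∈ Ioi (0:ℝ), ∀ x ∈ X n, |u n (t, x)| ≤ C) :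
    IsMVSubsolutionTWrt Xi di Hi (fun z : ℝ × Y => sSup {L : ℝ |
      ∃ tn : ℕ → ℝ, ∃ xn : ℕ → Y, (∀ n, xn n ∈ X n) ∧
        Tendsto tn atTop (𝓝 z.1) ∧ Tendsto xn atTop (𝓝 z.2) ∧
        Filter.limsup (fun n => u n (tn n, xn n)) atTop = L}) := by
  obtain ⟨C, hC⟩ := hbdd
  show IsMVSubsolutionTWrt Xi di Hi (upperSemilimit X u)
  intro ψ₁ ψ₂ dψ₁ dψ₂ h₁ h₂ hd₁ hc₁ hd₂ hc₂ hs hl z hz hmax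
  have hη : ∀ k : ℕ, (0:ℝ) < 1 / ((k:ℝ) + 1) := fun k => Nat.one_div_pos_of_nat
  have hη0 : Tendsto (fun k : ℕ => 1 / ((k:ℝ) + 1)) atTop (𝓝 0) :=
    tendsto_one_div_add_atTop_nhds_zero_nat
  choose n hnk w hwS r q hwz hr hq0 hqp hH using fun k : ℕ =>
    exists_approx_subsolution hXne hXc hXine hXic hmet hgeo hmeti hgeoi h1 h2 hsub hC
      h₁ h₂ hd₁ hc₁ hd₂ hc₂ hs hz (hl z hz) hmax (hη k) k
  set p := slopeSpWrt Xi di ψ₁ z with hp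
  set a := uscWrt (Ioi (0:ℝ) ×ˢ Xi) (slopeSpWrt Xi di ψ₂) z with ha
  set U := uscWrt (Ioi (0:ℝ) ×ˢ Xi) (upperSemilimit X u) z with hU
  have hqmem : ∀ k, q k ∈ Icc 0 (p + a + 1) := by
    intro k
    have h1k : 1 / ((k:ℝ) + 1) ≤ 1 := by
      rw [div_le_one (by positivity)]
      linarith [k.cast_nonneg (α := ℝ)]
    exact ⟨hq0 k, by linarith [(abs_le.1 (hqp k)).2]⟩
  obtain ⟨q₀, hq₀, φ, hφ, hφq⟩ := isCompact_Icc.tendsto_subseq hqmem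
  have hηφ : Tendsto (fun k => 1 / ((φ k : ℝ) + 1)) atTop (𝓝 0) := hη0.comp hφ.tendsto_atTop
  have hq₀p : |q₀ - p| ≤ a := by
    have hlim : Tendsto (fun k => a + 1 / ((φ k : ℝ) + 1)) atTop (𝓝 (a + 0)) :=
      hηφ.const_add a
    rw [add_zero] at hlim
    exact le_of_tendsto_of_tendsto' ((hφq.sub_const p).abs) hlim fun k => hqp (φ k)
  have hwlim : Tendsto (fun k => w (φ k)) atTop (𝓝 z) :=
    tendsto_iff_dist_tendsto_zero.2
      (squeeze_zero (fun _ => dist_nonneg) (fun k => hwz (φ k)) hηφ)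
  have hrlim : Tendsto (fun k => r (φ k)) atTop (𝓝 U) :=
    tendsto_iff_dist_tendsto_zero.2
      (squeeze_zero (fun _ => dist_nonneg) (fun k => hr (φ k)) hηφ)
  obtain ⟨e, he, hez⟩ := exists_mem_approximants hXne hXc hXic h1 hz.2
  have hle : dψ₁ z + dψ₂ z + Hi z.1 z.2 U q₀ ≤ 0 := by
    refine le_of_forall_pos_le_add fun θ hθ => ?_
    rw [zero_add]
    have hfreq : ∃ᶠ m in approxFilter (fun n => (Ioi (0:ℝ) ×ˢ X n) ×ˢ (univ : Set ℝ) ×ˢ Ici (0:ℝ))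
        (z, U, q₀), dψ₁ z + dψ₂ z + H m.1 m.2.1.1 m.2.1.2 m.2.2.1 m.2.2.2 ≤ θ := by
      refine frequently_approxFilter_of_tendsto
        (q := fun k => (n (φ k), w (φ k), r (φ k), q (φ k))) ?_ ?_ ?_ ?_
      · exact (tendsto_atTop_mono hnk tendsto_id).comp hφ.tendsto_atTop
      · exact hwlim.prodMk_nhds (hrlim.prodMk_nhds hφq)
      · exact fun k => ⟨hwS _, mem_univ _, hq0 _⟩
      · exact ((hηφ.eventually_le_const hθ).mono fun k hk => (hH (φ k)).trans hk).frequently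
    obtain ⟨v, hvS, hv, hvH⟩ := exists_seq_of_frequently_approxFilter
      (S := fun n => (Ioi (0:ℝ) ×ˢ X n) ×ˢ (univ : Set ℝ) ×ˢ Ici (0:ℝ)) (c := fun n => ((z.1, e n), U, q₀)) (fun n => ⟨⟨hz.1, he n⟩, mem_univ _, hq₀.1⟩)
      ((tendsto_const_nhds.prodMk_nhds hez).prodMk_nhds tendsto_const_nhds) hfreq
    have hv1 := (continuous_fst.tendsto _).comp hv
    have hv2 := (continuous_snd.tendsto _).comp hv
    have hlim := h3' z.1 hz.1 z.2 hz.2 _ (fun n => (hvS n).1.1)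
      ((continuous_fst.tendsto _).comp hv1) _ (fun n => (hvS n).1.2)
      ((continuous_snd.tendsto _).comp hv1) U q₀ hq₀.1 _ _ (fun n => (hvS n).2.2)
      ((continuous_fst.tendsto _).comp hv2) ((continuous_snd.tendsto _).comp hv2)
    exact le_of_tendsto_of_frequently (hlim.const_add (dψ₁ z + dψ₂ z)) hvH
  have hHq : ContinuousOn (fun q' => Hi z.1 z.2 U q') (Ici 0) :=
    hHic.comp (f := fun q' : ℝ => (z, U, q')) (by fun_prop) fun q' hq' => ⟨hz, mem_univ _, hq'⟩
  have hbelow : BddBelow (Hi z.1 z.2 U '' {q' | 0 ≤ q' ∧ |q' - p| ≤ a}) := by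
    have hsub : {q' | 0 ≤ q' ∧ |q' - p| ≤ a} ⊆ Icc 0 (p + a) := fun q' hq' =>
      ⟨hq'.1, by linarith [(abs_le.1 hq'.2).2]⟩
    exact (isCompact_Icc.bddBelow_image (hHq.mono Icc_subset_Ici_self)).mono (image_mono hsub)
  have hlow : Hlow (fun w : ℝ × Y => Hi w.1 w.2) a z U p ≤ Hi z.1 z.2 U q₀ :=
    csInf_le hbelow ⟨q₀, ⟨hq₀.1, hq₀p⟩, rfl⟩
  linarith
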